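/- arXiv:2104.04674 — 6 statements merged into one kernel-verified Lean document; each statement's English description precedes it below -/
import Mathlib

section
/- Let γ be the standard Gaussian measure on ℝ (density (2π)^{−1/2} e^{−x²/2}), let c ≠ 0 be a real number, and set f(x) := exp(c x − c²/2). Then: (a) ∫ f dγ = 1; (b) for every φ ∈ C_c^∞(ℝ), ∫ (φ''(x) + (c − x) φ'(x)) f(x) γ(dx) = 0, i.e. f·γ is a probability solution of the Kolmogorov equation with constant perturbation v ≡ c of the drift −x; (c) ∫ f^p dγ < ∞ for every p ≥ 1; (d) ∫ exp(ε f(x)) γ(dx) = ∞ for every ε > 0; (e) ∫ exp(ε (log f(x))²) γ(dx) < ∞ for every ε with 0 < ε < 1/(2c²). -/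
open MeasureTheory Real

noncomputable section

open ProbabilityTheory Filter

lemma gaussianPDFReal_zero_one (x : ℝ) :
    gaussianPDFReal 0 1 x = Real.exp (-x ^ 2 / 2) / Real.sqrt (2 * π) := by
  simp [gaussianPDFReal, div_eq_inv_mul]

lemma withDensity_exp_neg_sq_eq_gaussianReal :
    (volume.withDensity fun x : ℝ =>
      ENNReal.ofReal (Real.exp (-x ^ 2 / 2) / Real.sqrt (2 * π))) = gaussianReal 0 1 := by
  rw [gaussianReal_of_var_ne_zero 0 one_ne_zero]
  congr with x
  rw [gaussianPDF, gaussianPDFReal_zero_one]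

lemma integrable_gaussianReal_iff (g : ℝ → ℝ) :
    Integrable g (gaussianReal 0 1) ↔ Integrable (fun x => g x * gaussianPDFReal 0 1 x) := by
  rw [gaussianReal_of_var_ne_zero 0 one_ne_zero,
    integrable_withDensity_iff (measurable_gaussianPDF 0 1)
      (ae_of_all _ fun _ => gaussianPDF_lt_top)]
  simp only [toReal_gaussianPDF]

lemma hasDerivAt_gaussianPDFReal_zero_one (x : ℝ) :
    HasDerivAt (gaussianPDFReal 0 1) (-x * gaussianPDFReal 0 1 x) x := by
  have h : gaussianPDFReal 0 1 = fun x => Real.exp (-x ^ 2 / 2) / Real.sqrt (2 * π) :=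
    funext gaussianPDFReal_zero_one
  rw [h]
  have h1 : HasDerivAt (fun x : ℝ => -x ^ 2 / 2) (-x) x := by
    refine ((hasDerivAt_pow 2 x).neg.div_const 2).congr_deriv ?_
    norm_num
    ring
  refine (h1.exp.div_const _).congr_deriv ?_
  ring

lemma integral_gaussianReal_exp_linear (c : ℝ) :
    ∫ x, Real.exp (c * x - c ^ 2 / 2) ∂gaussianReal 0 1 = 1 := by
  have h := congrFun (mgf_fun_id_gaussianReal (μ := 0) (v := 1)) c
  simp only [mgf, NNReal.coe_one, zero_mul, one_mul, zero_add] at h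
  simp_rw [Real.exp_sub]
  rw [integral_div, h, div_self (Real.exp_ne_zero _)]

lemma integral_gaussianReal_kolmogorov (c : ℝ) {φ : ℝ → ℝ} (hφ : ContDiff ℝ (⊤ : ℕ∞) φ)
    (hs : HasCompactSupport φ) :
    ∫ x, (deriv (deriv φ) x + (c - x) * deriv φ x) * Real.exp (c * x - c ^ 2 / 2)
      ∂gaussianReal 0 1 = 0 := by
  have hφ' : ContDiff ℝ (⊤ : ℕ∞) (deriv φ) := (contDiff_infty_iff_deriv.mp hφ).2
  have hφ'' : ContDiff ℝ (⊤ : ℕ∞) (deriv (deriv φ)) := (contDiff_infty_iff_deriv.mp hφ').2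
  have hρ : Continuous (gaussianPDFReal 0 1) :=
    continuous_iff_continuousAt.mpr fun x => (hasDerivAt_gaussianPDFReal_zero_one x).continuousAt
  have c1 := hφ'.continuous
  have c2 := hφ''.continuous
  rw [integral_gaussianReal_eq_integral_smul one_ne_zero]
  refine integral_eq_zero_of_hasDerivAt_of_integrable
    (f := fun x => deriv φ x * (Real.exp (c * x - c ^ 2 / 2) * gaussianPDFReal 0 1 x))
    (fun x => ?_) ?_ ?_
  · have h1 : HasDerivAt (fun x : ℝ => c * x - c ^ 2 / 2) c x := by
      simpa using ((hasDerivAt_id x).const_mul c).sub_const (c ^ 2 / 2)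
    refine (((hφ'.differentiable (by simp)) x).hasDerivAt.mul
      (h1.exp.mul (hasDerivAt_gaussianPDFReal_zero_one x))).congr_deriv ?_
    simp only [smul_eq_mul, Pi.mul_apply]
    ring
  · refine Continuous.integrable_of_hasCompactSupport (by fun_prop) ?_
    have h1 : HasCompactSupport fun x => (c - x) * deriv φ x := hs.deriv.mul_left
    have h2 : HasCompactSupport fun x => deriv (deriv φ) x + (c - x) * deriv φ x :=
      hs.deriv.deriv.add h1
    have h3 : HasCompactSupport fun x =>
        (deriv (deriv φ) x + (c - x) * deriv φ x) * Real.exp (c * x - c ^ 2 / 2) := h2.mul_right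
    exact h3.mul_left
  · exact Continuous.integrable_of_hasCompactSupport (by fun_prop) hs.deriv.mul_right

lemma integrable_exp_quadratic {a : ℝ} (ha : a < 0) (b d : ℝ) :
    Integrable fun x : ℝ => Real.exp (a * x ^ 2 + b * x + d) := by
  have h := (integrable_cexp_quadratic' (b := (a : ℂ)) (by simpa using ha) b d).norm
  refine h.congr (ae_of_all _ fun x => ?_)
  simp only [Complex.norm_exp]
  congr 1
  norm_cast

lemma volume_setOf_le_mul {c : ℝ} (hc : c ≠ 0) (M : ℝ) : volume {x : ℝ | M ≤ c * x} = ⊤ := by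
  rcases hc.lt_or_gt with h | h
  · have : {x : ℝ | M ≤ c * x} = Set.Iic (M / c) := by
      ext x
      simp [le_div_iff_of_neg h, mul_comm]
    rw [this, Real.volume_Iic]
  · have : {x : ℝ | M ≤ c * x} = Set.Ici (M / c) := by
      ext x
      simp [div_le_iff₀ h, mul_comm]
    rw [this, Real.volume_Ici]

lemma exists_sq_le_mul_exp {c ε : ℝ} (hc : c ≠ 0) (hε : 0 < ε) :
    ∃ M : ℝ, ∀ x : ℝ, M ≤ c * x → x ^ 2 / 2 ≤ ε * Real.exp (c * x - c ^ 2 / 2) := by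
  have hK : 0 < 2 * c ^ 2 * ε * Real.exp (-(c ^ 2 / 2)) := by positivity
  obtain ⟨M, hM⟩ := eventually_atTop.mp
    ((isLittleO_pow_exp_atTop (n := 2)).bound hK)
  refine ⟨M, fun x hx => ?_⟩
  have h := hM (c * x) hx
  rw [Real.norm_of_nonneg (by positivity), Real.norm_of_nonneg (by positivity)] at h
  rw [sub_eq_add_neg, Real.exp_add]
  have hc2 : 0 < c ^ 2 := by positivity
  refine le_of_mul_le_mul_left ?_ hc2
  linarith

lemma lintegral_gaussianReal_exp_exp {c ε : ℝ} (hc : c ≠ 0) (hε : 0 < ε) :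
    ∫⁻ x, ENNReal.ofReal (Real.exp (ε * Real.exp (c * x - c ^ 2 / 2))) ∂gaussianReal 0 1 = ⊤ := by
  obtain ⟨M, hM⟩ := exists_sq_le_mul_exp hc hε
  rw [gaussianReal_of_var_ne_zero 0 one_ne_zero,
    lintegral_withDensity_eq_lintegral_mul _ (measurable_gaussianPDF 0 1) (by fun_prop)]
  have hS : MeasurableSet {x : ℝ | M ≤ c * x} := measurableSet_le (by fun_prop) (by fun_prop)
  rw [eq_top_iff]
  calc (⊤ : ENNReal)
      = ∫⁻ _ in {x : ℝ | M ≤ c * x}, ENNReal.ofReal (1 / Real.sqrt (2 * π)) := by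
        rw [setLIntegral_const, volume_setOf_le_mul hc, ENNReal.mul_top]
        exact (ENNReal.ofReal_pos.mpr (by positivity)).ne'
    _ ≤ ∫⁻ x in {x : ℝ | M ≤ c * x}, (gaussianPDF 0 1 *
          fun x => ENNReal.ofReal (Real.exp (ε * Real.exp (c * x - c ^ 2 / 2)))) x := by
        refine setLIntegral_mono' hS fun x hx => ?_
        rw [Pi.mul_apply, gaussianPDF, gaussianPDFReal_zero_one,
          ← ENNReal.ofReal_mul (by positivity), div_mul_eq_mul_div, ← Real.exp_add]
        refine ENNReal.ofReal_le_ofReal ?_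
        gcongr
        refine Real.one_le_exp ?_
        linarith [hM x hx]
    _ ≤ _ := setLIntegral_le_lintegral _ _

theorem stmt4 (c : ℝ) (hc : c ≠ 0)
    (γ : Measure ℝ)
    (hγ : γ = volume.withDensity fun x =>
      ENNReal.ofReal (Real.exp (-x ^ 2 / 2) / Real.sqrt (2 * π)))
    (f : ℝ → ℝ) (hf : f = fun x => Real.exp (c * x - c ^ 2 / 2)) :
    -- (a) f is a probability density with respect to γ
    (∫ x, f x ∂γ = 1) ∧
    -- (b) f·γ solves the Kolmogorov equation with drift -x perturbed by v ≡ c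
    (∀ φ : ℝ → ℝ, ContDiff ℝ (⊤ : ℕ∞) φ → HasCompactSupport φ →
      ∫ x, (deriv (deriv φ) x + (c - x) * deriv φ x) * f x ∂γ = 0) ∧
    -- (c) f ∈ L^p(γ) for all p ≥ 1
    (∀ p : ℝ, 1 ≤ p → Integrable (fun x => f x ^ p) γ) ∧
    -- (d) exp(ε f) is not γ-integrable for any ε > 0
    (∀ ε : ℝ, 0 < ε → ∫⁻ x, ENNReal.ofReal (Real.exp (ε * f x)) ∂γ = ⊤) ∧
    -- (e) exp(ε (log f)²) is γ-integrable for 0 < ε < 1/(2c²)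
    (∀ ε : ℝ, 0 < ε → ε < 1 / (2 * c ^ 2) →
      Integrable (fun x => Real.exp (ε * Real.log (f x) ^ 2)) γ) := by
  rw [withDensity_exp_neg_sq_eq_gaussianReal] at hγ
  subst hγ hf
  refine ⟨integral_gaussianReal_exp_linear c,
    fun φ hφ hs => integral_gaussianReal_kolmogorov c hφ hs, fun p _ => ?_,
    fun ε hε => lintegral_gaussianReal_exp_exp hc hε, fun ε hε hε' => ?_⟩
  · refine ((integrable_exp_mul_gaussianReal (μ := 0) (v := 1) (c * p)).mul_const
      (Real.exp (-(c ^ 2 / 2 * p)))).congr (ae_of_all _ fun x => ?_)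
    simp only
    rw [← Real.exp_mul, ← Real.exp_add]
    ring_nf
  · rw [integrable_gaussianReal_iff]
    have hc2 : 0 < 2 * c ^ 2 := by positivity
    have ha : ε * c ^ 2 - 1 / 2 < 0 := by
      have := (lt_div_iff₀ hc2).mp hε'
      linarith
    refine ((integrable_exp_quadratic ha (-(ε * c ^ 3)) (ε * c ^ 4 / 4)).div_const
      (Real.sqrt (2 * π))).congr (ae_of_all _ fun x => ?_)
    simp only [gaussianPDFReal_zero_one, Real.log_exp]
    rw [← mul_div_assoc, ← Real.exp_add]
    ring_nf
end
end

section
/- Let g : ℝ^d → [0, ∞) be a Borel function with ∫ g dγ = 1, let p ≥ 1 and set c_p := max(1, e^{p/2 − 1}). Then for every t > 0 and every coupling π of g·γ and γ one has ∫ T_t g · (log(c_p + T_t g))^{p/2} dγ ≤ 6^{p/2 + 1} (log(c_p + 1))^{p/2} + t^{−p/2} (3/2)^{p/2} ∫ |x − y|^p π(dx, dy). -/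
open MeasureTheory Real

noncomputable section

/-- The standard Gaussian measure on `ℝ^d` (Euclidean space). -/
def gaussE (d : ℕ) : Measure (EuclideanSpace ℝ (Fin d)) :=
  volume.withDensity fun x =>
    ENNReal.ofReal ((2 * π) ^ (-(d : ℝ) / 2) * Real.exp (-‖x‖ ^ 2 / 2))

/-- The Ornstein--Uhlenbeck (Mehler) semigroup with respect to the standard
Gaussian measure on `ℝ^d`. -/
def ouT (d : ℕ) (t : ℝ) (g : EuclideanSpace ℝ (Fin d) → ℝ)
    (x : EuclideanSpace ℝ (Fin d)) : ℝ :=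
  ∫ y, g (Real.exp (-t) • x + Real.sqrt (1 - Real.exp (-2 * t)) • y) ∂(gaussE d)

/-- `s ↦ (log s) ^ q` is concave on `[c, ∞)` as soon as `c ≥ 1` and `log c ≥ q - 1`. -/
theorem concaveOn_log_rpow {q c : ℝ} (hq : 0 < q) (hc1 : 1 ≤ c) (hcq : q - 1 ≤ log c) :
    ConcaveOn ℝ (Set.Ici c) fun s => log s ^ q := by
  have hderiv : ∀ s ∈ Set.Ioi c,
      HasDerivAt (fun s => log s ^ q) (s⁻¹ * q * log s ^ (q - 1)) s := fun s hs => by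
    have hs1 : 1 < s := lt_of_le_of_lt hc1 hs
    exact (hasDerivAt_log (by linarith)).rpow_const (Or.inl (log_pos hs1).ne')
  apply AntitoneOn.concaveOn_of_deriv (convex_Ici c)
  · refine ContinuousOn.rpow_const (continuousOn_log.mono fun s hs => ?_) fun s _ => Or.inr hq.le
    have : c ≤ s := hs
    simp only [Set.mem_compl_iff, Set.mem_singleton_iff]
    linarith
  · rw [interior_Ici]
    exact fun s hs => (hderiv s hs).differentiableAt.differentiableWithinAt
  · rw [interior_Ici]
    intro s hs r hr hsr
    rw [(hderiv s hs).deriv, (hderiv r hr).deriv]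
    have hs1 : 1 < s := lt_of_le_of_lt hc1 hs
    have hr1 : 1 < r := lt_of_le_of_lt hc1 hr
    have hls := log_pos hs1
    have hlr := log_pos hr1
    have key : ∀ x : ℝ, 1 < x →
        x⁻¹ * q * log x ^ (q - 1) = q * exp ((q - 1) * log (log x) - log x) := fun x hx => by
      rw [exp_sub, exp_log (by linarith), rpow_def_of_pos (log_pos hx), mul_comm (q - 1)]
      field_simp
    rw [key s hs1, key r hr1]
    have hlsr : log s ≤ log r := log_le_log (by linarith) hsr
    have hll : log (log s) ≤ log (log r) := log_le_log hls hlsr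
    have hcs : log c ≤ log s := log_le_log (by linarith) (le_of_lt hs)
    gcongr q * exp ?_
    rcases le_total q 1 with h | h
    · nlinarith
    · have h1 : log (log r) - log (log s) ≤ log r / log s - 1 := by
        rw [← log_div hlr.ne' hls.ne']
        exact log_le_sub_one_of_pos (by positivity)
      have h2 : (q - 1) * (log r / log s - 1) ≤ log s * (log r / log s - 1) := by
        apply mul_le_mul_of_nonneg_right (by linarith)
        rw [sub_nonneg, one_le_div hls]
        exact hlsr
      have h3 : log s * (log r / log s - 1) = log r - log s := by field_simp
      have h4 := mul_le_mul_of_nonneg_left h1 (sub_nonneg.2 h)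
      linarith

theorem lintegral_log_rpow_le {α : Type*} [MeasurableSpace α] {μ : Measure α}
    [IsProbabilityMeasure μ] {q c : ℝ} (hq : 0 < q) (hc1 : 1 ≤ c) (hcq : q - 1 ≤ log c)
    {f : α → ℝ} (hf : Measurable f) (hcf : ∀ x, c ≤ f x) (hfi : Integrable f μ) :
    ∫⁻ x, ENNReal.ofReal (log (f x) ^ q) ∂μ ≤ ENNReal.ofReal (log (∫ x, f x ∂μ) ^ q) := by
  have hlog : ∀ x, 0 ≤ log (f x) := fun x => log_nonneg (hc1.trans (hcf x))
  have hint : Integrable (fun x => log (f x) ^ q) μ := by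
    refine (hfi.const_mul (q ^ q)).mono' (hf.log.pow_const q).aestronglyMeasurable
      (ae_of_all _ fun x => ?_)
    have hx : 0 ≤ f x := zero_le_one.trans (hc1.trans (hcf x))
    rw [norm_of_nonneg (rpow_nonneg (hlog x) q)]
    calc log (f x) ^ q ≤ (f x ^ (1 / q) / (1 / q)) ^ q :=
          rpow_le_rpow (hlog x) (log_le_rpow_div hx (by positivity)) hq.le
      _ = (q * f x ^ (1 / q)) ^ q := by rw [div_div_eq_mul_div, div_one, mul_comm]
      _ = q ^ q * f x := by
          rw [mul_rpow hq.le (by positivity), ← rpow_mul hx, one_div_mul_cancel hq.ne', rpow_one]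
  rw [← ofReal_integral_eq_lintegral_ofReal hint
    (ae_of_all _ fun x => rpow_nonneg (hlog x) q)]
  apply ENNReal.ofReal_le_ofReal
  have hcont : ContinuousOn (fun s => log s ^ q) (Set.Ici c) := by
    refine ContinuousOn.rpow_const (continuousOn_log.mono fun s hs => ?_) fun s _ => Or.inr hq.le
    have : c ≤ s := hs
    simp only [Set.mem_compl_iff, Set.mem_singleton_iff]
    linarith
  exact (concaveOn_log_rpow hq hc1 hcq).le_map_integral hcont isClosed_Ici
    (ae_of_all _ hcf) hfi hint

theorem lintegral_gaussE (d : ℕ) {f : EuclideanSpace ℝ (Fin d) → ENNReal} (hf : Measurable f) :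
    ∫⁻ x, f x ∂(gaussE d) = ∫⁻ x, ENNReal.ofReal
      ((2 * π) ^ (-(d : ℝ) / 2) * Real.exp (-‖x‖ ^ 2 / 2)) * f x := by
  rw [gaussE, lintegral_withDensity_eq_lintegral_mul _ (by fun_prop) hf]
  rfl

/-- The Cameron–Martin formula for translations of the standard Gaussian measure. -/
theorem lintegral_gaussE_add_right (d : ℕ) {f : EuclideanSpace ℝ (Fin d) → ENNReal}
    (hf : Measurable f) (m : EuclideanSpace ℝ (Fin d)) :
    ∫⁻ x, f (x + m) ∂(gaussE d) =
      ∫⁻ x, f x * ENNReal.ofReal (exp (inner ℝ x m - ‖m‖ ^ 2 / 2)) ∂(gaussE d) := by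
  rw [lintegral_gaussE d (by fun_prop), lintegral_gaussE d (by fun_prop),
    ← lintegral_add_right_eq_self (μ := volume) (fun x => ENNReal.ofReal
      ((2 * π) ^ (-(d : ℝ) / 2) * Real.exp (-‖x‖ ^ 2 / 2)) *
        (f x * ENNReal.ofReal (exp (inner ℝ x m - ‖m‖ ^ 2 / 2)))) m]
  refine lintegral_congr fun x => ?_
  rw [mul_comm (f (x + m)), ← mul_assoc, ← ENNReal.ofReal_mul (by positivity), mul_assoc,
    ← exp_add]
  congr 4
  rw [norm_add_sq_real, inner_add_left, real_inner_self_eq_norm_sq]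
  ring

/-- A Harnack-type inequality for translations of the standard Gaussian measure. -/
theorem lintegral_gaussE_add_right_le (d : ℕ) [IsProbabilityMeasure (gaussE d)]
    {f : EuclideanSpace ℝ (Fin d) → ENNReal} (hf : Measurable f)
    (m : EuclideanSpace ℝ (Fin d)) :
    ∫⁻ x, f (x + m) ∂(gaussE d) ≤
      (∫⁻ x, f x ^ (2 : ℝ) ∂(gaussE d)) ^ (1 / 2 : ℝ) * ENNReal.ofReal (exp (‖m‖ ^ 2 / 2)) := by
  rw [lintegral_gaussE_add_right d hf m]
  refine (ENNReal.lintegral_mul_le_Lp_mul_Lq (gaussE d) Real.HolderConjugate.two_two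
    hf.aemeasurable (by fun_prop)).trans_eq ?_
  congr 1
  have h1 : ∀ x : EuclideanSpace ℝ (Fin d),
      ENNReal.ofReal (exp (inner ℝ x m - ‖m‖ ^ 2 / 2)) ^ (2 : ℝ) =
        ENNReal.ofReal (exp (‖m‖ ^ 2)) * (1 *
          ENNReal.ofReal (exp (inner ℝ x ((2 : ℝ) • m) - ‖(2 : ℝ) • m‖ ^ 2 / 2))) := fun x => by
    rw [one_mul, ENNReal.ofReal_rpow_of_pos (exp_pos _), ← ENNReal.ofReal_mul (exp_pos _).le,
      ← exp_add, ← exp_mul, inner_smul_right, norm_smul]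
    congr 2
    norm_num
    ring
  simp_rw [h1]
  rw [lintegral_const_mul _ (by fun_prop),
    ← lintegral_gaussE_add_right d (f := fun _ => 1) measurable_const]
  simp only [lintegral_const, measure_univ, mul_one]
  rw [ENNReal.ofReal_rpow_of_pos (exp_pos _), ← exp_mul]
  congr 2
  ring

/-- The orthogonal reflection `(x, y) ↦ (a x + b y, b x - a y)`. -/
def prodReflection (E : Type*) [AddCommGroup E] [Module ℝ E] (a b : ℝ) : E × E →ₗ[ℝ] E × E :=
  (a • LinearMap.fst ℝ E E + b • LinearMap.snd ℝ E E).prod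
    (b • LinearMap.fst ℝ E E - a • LinearMap.snd ℝ E E)

theorem prodReflection_apply {E : Type*} [AddCommGroup E] [Module ℝ E] (a b : ℝ) (z : E × E) :
    prodReflection E a b z = (a • z.1 + b • z.2, b • z.1 - a • z.2) := rfl

theorem prodReflection_comp_self {E : Type*} [AddCommGroup E] [Module ℝ E] {a b : ℝ}
    (hab : a ^ 2 + b ^ 2 = 1) : prodReflection E a b ∘ₗ prodReflection E a b = LinearMap.id := by
  ext z
  all_goals
    simp only [LinearMap.comp_apply, prodReflection_apply, LinearMap.inl_apply,
      LinearMap.inr_apply, LinearMap.id_apply]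
    match_scalars
    linarith

theorem lintegral_comp_prodReflection {E : Type*} [NormedAddCommGroup E] [NormedSpace ℝ E]
    [FiniteDimensional ℝ E] [MeasurableSpace E] [BorelSpace E] (μ : Measure (E × E))
    [μ.IsAddHaarMeasure] {a b : ℝ} (hab : a ^ 2 + b ^ 2 = 1) {f : E × E → ENNReal}
    (hf : Measurable f) : ∫⁻ z, f (prodReflection E a b z) ∂μ = ∫⁻ z, f z ∂μ := by
  have hdet : LinearMap.det (prodReflection E a b) * LinearMap.det (prodReflection E a b) = 1 := by
    rw [← LinearMap.det_comp, prodReflection_comp_self hab, LinearMap.det_id]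
  have hmap : μ.map (prodReflection E a b) = μ := by
    rw [Measure.map_linearMap_addHaar_eq_smul_addHaar μ (left_ne_zero_of_mul_eq_one hdet)]
    have : |(LinearMap.det (prodReflection E a b))⁻¹| = 1 := by
      rcases mul_self_eq_one_iff.1 hdet with h | h <;> simp [h]
    simp [this]
  conv_rhs => rw [← hmap]
  rw [lintegral_map hf (LinearMap.continuous_of_finiteDimensional _).measurable]

/-- Symmetry of the Mehler kernel with respect to the standard Gaussian measure. -/
theorem lintegral_gaussE_mehler_symm (d : ℕ) [IsProbabilityMeasure (gaussE d)] {a b : ℝ}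
    (hab : a ^ 2 + b ^ 2 = 1) {f g : EuclideanSpace ℝ (Fin d) → ENNReal} (hf : Measurable f)
    (hg : Measurable g) :
    ∫⁻ x, (∫⁻ y, g (a • x + b • y) ∂(gaussE d)) * f x ∂(gaussE d) =
      ∫⁻ x, g x * ∫⁻ y, f (a • x + b • y) ∂(gaussE d) ∂(gaussE d) := by
  let r : EuclideanSpace ℝ (Fin d) → ENNReal := fun x => ENNReal.ofReal
    ((2 * π) ^ (-(d : ℝ) / 2) * Real.exp (-‖x‖ ^ 2 / 2))
  have hr : Measurable r := by fun_prop
  have hprod : ∀ h : EuclideanSpace ℝ (Fin d) × EuclideanSpace ℝ (Fin d) → ENNReal,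
      Measurable h → ∫⁻ x, ∫⁻ y, h (x, y) ∂(gaussE d) ∂(gaussE d) =
        ∫⁻ z, r z.1 * r z.2 * h z ∂((volume : Measure (EuclideanSpace ℝ (Fin d))).prod
          (volume : Measure (EuclideanSpace ℝ (Fin d)))) := fun h hh => by
    rw [lintegral_prod _ (by fun_prop), lintegral_gaussE d (by fun_prop)]
    refine lintegral_congr fun x => ?_
    rw [lintegral_gaussE d (by fun_prop), ← lintegral_const_mul _ (by fun_prop)]
    exact lintegral_congr fun y => (mul_assoc _ _ _).symm
  have h1 : ∀ x, (∫⁻ y, g (a • x + b • y) ∂(gaussE d)) * f x =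
      ∫⁻ y, g (a • x + b • y) * f x ∂(gaussE d) := fun x =>
    (lintegral_mul_const _ (by fun_prop)).symm
  have h2 : ∀ x, g x * ∫⁻ y, f (a • x + b • y) ∂(gaussE d) =
      ∫⁻ y, g x * f (a • x + b • y) ∂(gaussE d) := fun x =>
    (lintegral_const_mul _ (by fun_prop)).symm
  simp_rw [h1, h2]
  rw [hprod (fun z => g (a • z.1 + b • z.2) * f z.1) (by fun_prop),
    hprod (fun z => g z.1 * f (a • z.1 + b • z.2)) (by fun_prop),
    ← lintegral_comp_prodReflection _ hab (by fun_prop)]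
  refine lintegral_congr fun z => ?_
  have hinv : prodReflection _ a b (prodReflection _ a b z) = z :=
    LinearMap.congr_fun (prodReflection_comp_self hab) z
  have hfst : a • (prodReflection _ a b z).1 + b • (prodReflection _ a b z).2 = z.1 :=
    congrArg Prod.fst hinv
  rw [hfst]
  have hrr : r (prodReflection _ a b z).1 * r (prodReflection _ a b z).2 = r z.1 * r z.2 := by
    simp only [r, prodReflection_apply]
    have hexp : ∀ C s t : ℝ, C * exp s * (C * exp t) = C * C * exp (s + t) := fun C s t => by
      rw [exp_add]
      ring
    rw [← ENNReal.ofReal_mul (by positivity), ← ENNReal.ofReal_mul (by positivity), hexp, hexp]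
    congr 3
    rw [norm_add_sq_real, norm_sub_sq_real]
    simp only [norm_smul, inner_smul_left, inner_smul_right, mul_pow, norm_eq_abs, sq_abs]
    simp only [conj_trivial]
    linear_combination (-(‖z.1‖ ^ 2 + ‖z.2‖ ^ 2) / 2) * hab
  rw [hrr, prodReflection_apply]

theorem add_rpow_le_three_halves_rpow_add {q A B : ℝ} (hq : 0 < q) (hA : 0 ≤ A) (hB : 0 ≤ B) :
    (A + B) ^ q ≤ (3 / 2 * A) ^ q + (3 * B) ^ q := by
  rcases le_total (2 * B) A with h | h
  · have h1 : (A + B) ^ q ≤ (3 / 2 * A) ^ q :=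
      rpow_le_rpow (by positivity) (by linarith) hq.le
    have h2 : 0 ≤ (3 * B) ^ q := by positivity
    linarith
  · have h1 : (A + B) ^ q ≤ (3 * B) ^ q :=
      rpow_le_rpow (by positivity) (by linarith) hq.le
    have h2 : 0 ≤ (3 / 2 * A) ^ q := by positivity
    linarith

/-- A Harnack-type inequality for `log ^ q`, comparing the standard Gaussian measure with its
translate by `m`. -/
theorem lintegral_log_rpow_gaussE_add_right_le (d : ℕ) [IsProbabilityMeasure (gaussE d)]
    {q c : ℝ} (hq : 0 < q) (hc1 : 1 ≤ c) (hcq : q - 1 ≤ log c)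
    {f : EuclideanSpace ℝ (Fin d) → ℝ} (hf : Measurable f) (hcf : ∀ x, c ^ 2 ≤ f x)
    (hfi : Integrable f (gaussE d)) (m : EuclideanSpace ℝ (Fin d)) :
    ∫⁻ x, ENNReal.ofReal (log (f (x + m)) ^ q) ∂(gaussE d) ≤
      ENNReal.ofReal ((log (∫ x, f x ∂(gaussE d)) + ‖m‖ ^ 2) ^ q) := by
  have hc0 : 0 ≤ c := zero_le_one.trans hc1
  have hf1 : ∀ x, 1 ≤ f x := fun x => (one_le_pow₀ hc1).trans (hcf x)
  have hf0 : ∀ x, 0 ≤ f x := fun x => zero_le_one.trans (hf1 x)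
  set V := ∫ x, f x ∂(gaussE d) with hV
  have hV1 : 1 ≤ V := by
    have := integral_mono (integrable_const (1 : ℝ)) hfi hf1
    simpa using this
  have hcs : ∀ x, c ≤ √(f x) := fun x => le_sqrt_of_sq_le (hcf x)
  have hbound : ∫⁻ x, ENNReal.ofReal √(f (x + m)) ∂(gaussE d) ≤
      ENNReal.ofReal (√V * exp (‖m‖ ^ 2 / 2)) := by
    refine (lintegral_gaussE_add_right_le d (f := fun x => ENNReal.ofReal √(f x))
      (by fun_prop) m).trans_eq ?_
    have hsq : ∀ x, ENNReal.ofReal √(f x) ^ (2 : ℝ) = ENNReal.ofReal (f x) := fun x => by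
      rw [ENNReal.ofReal_rpow_of_nonneg (sqrt_nonneg _) (by norm_num), rpow_two,
        sq_sqrt (hf0 x)]
    simp_rw [hsq]
    rw [← ofReal_integral_eq_lintegral_ofReal hfi (ae_of_all _ hf0),
      ENNReal.ofReal_rpow_of_nonneg (by linarith) (by norm_num), ← sqrt_eq_rpow,
      ← ENNReal.ofReal_mul (sqrt_nonneg _)]
  have hsm : Measurable fun x => √(f (x + m)) := by fun_prop
  have hsi : Integrable (fun x => √(f (x + m))) (gaussE d) := by
    refine ⟨hsm.aestronglyMeasurable, ?_⟩
    rw [hasFiniteIntegral_iff_ofReal (ae_of_all _ fun x => sqrt_nonneg _)]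
    exact hbound.trans_lt ENNReal.ofReal_lt_top
  have hsV : ∫ x, √(f (x + m)) ∂(gaussE d) ≤ √V * exp (‖m‖ ^ 2 / 2) := by
    rw [integral_eq_lintegral_of_nonneg_ae (ae_of_all _ fun x => sqrt_nonneg _)
      hsm.aestronglyMeasurable]
    exact ENNReal.toReal_le_of_le_ofReal (by positivity) hbound
  have hs1 : 1 ≤ ∫ x, √(f (x + m)) ∂(gaussE d) := by
    have := integral_mono (integrable_const (1 : ℝ)) hsi fun x => hc1.trans (hcs (x + m))
    simpa using this
  have hlog : ∀ x, ENNReal.ofReal (log (f (x + m)) ^ q) =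
      ENNReal.ofReal (2 ^ q) * ENNReal.ofReal (log √(f (x + m)) ^ q) := fun x => by
    rw [← ENNReal.ofReal_mul (by positivity), ← mul_rpow (by norm_num)
      (log_nonneg (hc1.trans (hcs _))), log_sqrt (hf0 _)]
    congr 2
    ring
  simp_rw [hlog]
  rw [lintegral_const_mul _ (by fun_prop)]
  refine (mul_le_mul_right (lintegral_log_rpow_le hq hc1 hcq hsm (fun x => hcs (x + m)) hsi)
    _).trans ?_
  rw [← ENNReal.ofReal_mul (by positivity), ← mul_rpow (by norm_num) (log_nonneg hs1)]
  apply ENNReal.ofReal_le_ofReal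
  apply rpow_le_rpow (mul_nonneg (by norm_num) (log_nonneg hs1)) _ hq.le
  have h1 := log_le_log (by linarith) hsV
  rw [log_mul (by positivity) (exp_pos _).ne', log_exp, log_sqrt (by linarith)] at h1
  linarith

theorem stmt8 (d : ℕ)
    (g : EuclideanSpace ℝ (Fin d) → ℝ) (hgmeas : Measurable g) (hg0 : ∀ x, 0 ≤ g x)
    (hg1 : ∫ x, g x ∂(gaussE d) = 1)
    (p : ℝ) (hp : 1 ≤ p) (cp : ℝ) (hcp : cp = max 1 (Real.exp (p / 2 - 1)))
    (t : ℝ) (ht : 0 < t)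
    (cpl : Measure (EuclideanSpace ℝ (Fin d) × EuclideanSpace ℝ (Fin d)))
    (hcpl : IsProbabilityMeasure cpl)
    (hfst : cpl.map Prod.fst = (gaussE d).withDensity (fun x => ENNReal.ofReal (g x)))
    (hsnd : cpl.map Prod.snd = gaussE d) :
    ∫⁻ x, ENNReal.ofReal (ouT d t g x * Real.log (cp + ouT d t g x) ^ (p / 2)) ∂(gaussE d) ≤
      ENNReal.ofReal (6 ^ (p / 2 + 1) * Real.log (cp + 1) ^ (p / 2)) +
        ENNReal.ofReal (t ^ (-p / 2) * (3 / 2) ^ (p / 2)) *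
          ∫⁻ z, ENNReal.ofReal (‖z.1 - z.2‖ ^ p) ∂cpl := by
  have : IsProbabilityMeasure (gaussE d) :=
    hsnd ▸ Measure.isProbabilityMeasure_map measurable_snd.aemeasurable
  set q := p / 2 with hq_def
  have hq : 0 < q := by linarith
  have hc1 : 1 ≤ cp := hcp ▸ le_max_left _ _
  have hcq : q - 1 ≤ log cp := by
    rw [le_log_iff_exp_le (by linarith), hcp]
    exact le_max_right _ _
  set a := Real.exp (-t) with ha
  set b := Real.sqrt (1 - Real.exp (-2 * t)) with hb
  have ha0 : 0 < a := exp_pos _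
  have ha2 : a ^ 2 = Real.exp (-2 * t) := by
    rw [ha, ← exp_nat_mul]
    congr 1
    push_cast
    ring
  have ha1 : Real.exp (-2 * t) < 1 := by
    rw [exp_lt_one_iff]
    linarith
  have hb0 : 0 < b := sqrt_pos.2 (by linarith)
  have hab : a ^ 2 + b ^ 2 = 1 := by
    rw [hb, sq_sqrt (by linarith), ha2]
    ring
  have hratio : (a / b) ^ 2 ≤ 1 / (2 * t) := by
    rw [div_pow, div_le_div_iff₀ (by positivity) (by positivity)]
    have h1 : 2 * t + 1 ≤ Real.exp (2 * t) := add_one_le_exp _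
    have h2 : a ^ 2 * Real.exp (2 * t) = 1 := by
      rw [ha2, ← exp_add]
      simp
    nlinarith [sq_nonneg a]
  let G : EuclideanSpace ℝ (Fin d) → ENNReal := fun x => ENNReal.ofReal (g x)
  have hG : Measurable G := by fun_prop
  have hG1 : ∫⁻ x, G x ∂(gaussE d) = 1 := by
    have hgi : Integrable g (gaussE d) := by
      by_contra h
      rw [integral_undef h] at hg1
      exact zero_ne_one hg1
    rw [← ofReal_integral_eq_lintegral_ofReal hgi (ae_of_all _ hg0), hg1, ENNReal.ofReal_one]
  let U : EuclideanSpace ℝ (Fin d) → ENNReal := fun x => ∫⁻ y, G (a • x + b • y) ∂(gaussE d)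
  have hU : Measurable U := by
    have : Measurable fun z : EuclideanSpace ℝ (Fin d) × EuclideanSpace ℝ (Fin d) =>
      G (a • z.1 + b • z.2) := by fun_prop
    exact this.lintegral_prod_right'
  have hU1 : ∫⁻ x, U x ∂(gaussE d) = 1 := by
    have := lintegral_gaussE_mehler_symm d hab (f := fun _ => 1) measurable_const hG
    simpa [hG1] using this
  let u := ouT d t g
  have huU : ∀ x, u x = (U x).toReal := fun x =>
    integral_eq_lintegral_of_nonneg_ae (ae_of_all _ fun y => hg0 _)
      (Measurable.aestronglyMeasurable (by fun_prop))
  have hu : Measurable u := by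
    rw [funext huU]
    exact hU.ennreal_toReal
  have hu0 : ∀ x, 0 ≤ u x := fun x => huU x ▸ ENNReal.toReal_nonneg
  have huleU : ∀ x, ENNReal.ofReal (u x) ≤ U x := fun x => huU x ▸ ENNReal.ofReal_toReal_le
  let h : EuclideanSpace ℝ (Fin d) → ℝ := fun x => cp ^ 2 + u x
  have hh : Measurable h := by fun_prop
  have hch : ∀ x, cp ^ 2 ≤ h x := fun x => le_add_of_nonneg_right (hu0 x)
  have hh1 : ∀ x, 1 ≤ h x := fun x => (one_le_pow₀ hc1).trans (hch x)
  -- the random variable `h (a x + b y)` under the product measure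
  let k : EuclideanSpace ℝ (Fin d) → EuclideanSpace ℝ (Fin d) → ℝ := fun x y => h (a • x + b • y)
  have hu2 : ∫⁻ x, ∫⁻ y, ENNReal.ofReal (u (a • x + b • y)) ∂(gaussE d) ∂(gaussE d) ≤ 1 := by
    have := lintegral_gaussE_mehler_symm d hab (f := fun _ => 1) measurable_const hU
    simp only [mul_one, lintegral_const, measure_univ, hU1] at this
    rw [← this]
    exact lintegral_mono fun x => lintegral_mono fun y => huleU _
  have hui : Integrable (fun z : EuclideanSpace ℝ (Fin d) × EuclideanSpace ℝ (Fin d) =>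
      u (a • z.1 + b • z.2)) ((gaussE d).prod (gaussE d)) := by
    refine ⟨Measurable.aestronglyMeasurable (by fun_prop), ?_⟩
    rw [hasFiniteIntegral_iff_ofReal (ae_of_all _ fun z => hu0 _),
      lintegral_prod _ (Measurable.aemeasurable (by fun_prop))]
    exact hu2.trans_lt ENNReal.one_lt_top
  have hki : Integrable (fun z : EuclideanSpace ℝ (Fin d) × EuclideanSpace ℝ (Fin d) =>
      k z.1 z.2) ((gaussE d).prod (gaussE d)) := (integrable_const (cp ^ 2)).add hui
  have hkm : Measurable fun z : EuclideanSpace ℝ (Fin d) × EuclideanSpace ℝ (Fin d) =>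
      k z.1 z.2 := by fun_prop
  let V : EuclideanSpace ℝ (Fin d) → ℝ := fun x => ∫ y, k x y ∂(gaussE d)
  have hVm : Measurable V := hkm.stronglyMeasurable.integral_prod_right'.measurable
  have hki_ae : ∀ᵐ x ∂(gaussE d), Integrable (k x) (gaussE d) := hki.prod_right_ae
  have hVi : Integrable V (gaussE d) := hki.integral_prod_left
  have hVc : ∀ᵐ x ∂(gaussE d), cp ^ 2 ≤ V x := by
    filter_upwards [hki_ae] with x hx
    simpa using integral_mono (integrable_const (cp ^ 2)) hx fun y => hch _
  have hV1 : ∫ x, V x ∂(gaussE d) ≤ cp ^ 2 + 1 := by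
    rw [← integral_prod _ hki]
    change ∫ z, (cp ^ 2 + u (a • z.1 + b • z.2)) ∂((gaussE d).prod (gaussE d)) ≤ _
    rw [integral_add (integrable_const _) hui]
    have h1 : ∫ z, u (a • z.1 + b • z.2) ∂((gaussE d).prod (gaussE d)) ≤ 1 := by
      rw [integral_eq_lintegral_of_nonneg_ae (ae_of_all _ fun z => hu0 _)
        hui.aestronglyMeasurable,
        lintegral_prod _ (Measurable.aemeasurable (by fun_prop))]
      exact ENNReal.toReal_le_of_le_ofReal zero_le_one (by simpa using hu2)
    simpa using h1
  have hcc : cp ≤ cp ^ 2 := by nlinarith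
  have hJensen : ∫⁻ x, ENNReal.ofReal (log (V x) ^ q) ∂(gaussE d) ≤
      ENNReal.ofReal ((2 * log (cp + 1)) ^ q) := by
    let W : EuclideanSpace ℝ (Fin d) → ℝ := fun x => max cp (V x)
    have hWV : W =ᵐ[gaussE d] V := by
      filter_upwards [hVc] with x hx
      exact max_eq_right (hcc.trans hx)
    have hWi : Integrable W (gaussE d) := hVi.congr hWV.symm
    calc ∫⁻ x, ENNReal.ofReal (log (V x) ^ q) ∂(gaussE d)
        = ∫⁻ x, ENNReal.ofReal (log (W x) ^ q) ∂(gaussE d) :=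
          lintegral_congr_ae (hWV.symm.mono fun x hx => by simp only [hx])
      _ ≤ ENNReal.ofReal (log (∫ x, W x ∂(gaussE d)) ^ q) :=
          lintegral_log_rpow_le hq hc1 hcq (by fun_prop) (fun x => le_max_left _ _) hWi
      _ ≤ ENNReal.ofReal ((2 * log (cp + 1)) ^ q) := by
          have h1 : cp ≤ ∫ x, W x ∂(gaussE d) := by
            simpa using integral_mono (integrable_const cp) hWi fun x => le_max_left _ _
          have h2 : ∫ x, W x ∂(gaussE d) ≤ (cp + 1) ^ 2 := by
            rw [integral_congr_ae hWV]
            nlinarith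
          have h3 := log_le_log (by linarith) h2
          rw [log_pow, Nat.cast_two] at h3
          exact ENNReal.ofReal_le_ofReal
            (rpow_le_rpow (log_nonneg (hc1.trans h1)) h3 hq.le)
  let F : EuclideanSpace ℝ (Fin d) → ENNReal := fun x => ENNReal.ofReal (log (h x) ^ q)
  have hF : Measurable F := by fun_prop
  let TF : EuclideanSpace ℝ (Fin d) → ENNReal := fun x => ∫⁻ y, F (a • x + b • y) ∂(gaussE d)
  have hTF : Measurable TF := by
    have : Measurable fun z : EuclideanSpace ℝ (Fin d) × EuclideanSpace ℝ (Fin d) =>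
      F (a • z.1 + b • z.2) := by fun_prop
    exact this.lintegral_prod_right'
  have hpoint : ∀ x y, Integrable (k y) (gaussE d) → TF x ≤
      ENNReal.ofReal ((3 / 2) ^ q) * ENNReal.ofReal (log (V y) ^ q) +
        ENNReal.ofReal (t ^ (-p / 2) * (3 / 2) ^ q) * ENNReal.ofReal (‖x - y‖ ^ p) := by
    intro x y hy
    set m := (a / b) • (x - y) with hm
    have hshift : ∀ z, a • x + b • z = a • y + b • (z + m) := fun z => by
      rw [hm, smul_add, smul_smul, mul_div_cancel₀ _ hb0.ne', smul_sub]
      abel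
    have hVy : 0 ≤ log (V y) := log_nonneg <| by
      simpa using integral_mono (integrable_const (1 : ℝ)) hy fun z => hh1 _
    have h1 : TF x ≤ ENNReal.ofReal ((log (V y) + ‖m‖ ^ 2) ^ q) := by
      simp only [TF, F, hshift]
      exact lintegral_log_rpow_gaussE_add_right_le d hq hc1 hcq (f := k y) (by fun_prop)
        (fun z => hch _) hy m
    have h2 : (3 * ‖m‖ ^ 2) ^ q ≤ t ^ (-p / 2) * (3 / 2) ^ q * ‖x - y‖ ^ p := by
      have h3 : 3 * ‖m‖ ^ 2 ≤ t⁻¹ * (3 / 2) * ‖x - y‖ ^ 2 := by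
        rw [hm, norm_smul, mul_pow, norm_eq_abs, sq_abs]
        have := mul_le_mul_of_nonneg_right hratio (sq_nonneg ‖x - y‖)
        calc 3 * ((a / b) ^ 2 * ‖x - y‖ ^ 2) ≤ 3 * (1 / (2 * t) * ‖x - y‖ ^ 2) := by linarith
          _ = t⁻¹ * (3 / 2) * ‖x - y‖ ^ 2 := by
            field_simp
      refine (rpow_le_rpow (by positivity) h3 hq.le).trans_eq ?_
      rw [mul_rpow (by positivity) (by positivity), mul_rpow (by positivity) (by positivity),
        inv_rpow ht.le, ← rpow_neg ht.le, ← rpow_natCast, ← rpow_mul (norm_nonneg _), hq_def,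
        neg_div]
      congr 2
      push_cast
      ring
    rw [← ENNReal.ofReal_mul (by positivity), ← ENNReal.ofReal_mul (by positivity),
      ← ENNReal.ofReal_add (by positivity) (by positivity)]
    refine h1.trans (ENNReal.ofReal_le_ofReal ?_)
    refine (add_rpow_le_three_halves_rpow_add hq hVy (by positivity)).trans ?_
    rw [mul_rpow (by norm_num) hVy]
    linarith
  have hae : ∀ᵐ z ∂cpl, Integrable (k z.2) (gaussE d) := by
    rw [← hsnd] at hki_ae
    have := ae_of_ae_map measurable_snd.aemeasurable hki_ae
    simpa only [hsnd] using this
  calc ∫⁻ x, ENNReal.ofReal (ouT d t g x * Real.log (cp + ouT d t g x) ^ q) ∂(gaussE d)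
      ≤ ∫⁻ x, U x * F x ∂(gaussE d) := by
        refine lintegral_mono fun x => ?_
        rw [ENNReal.ofReal_mul (hu0 x)]
        refine mul_le_mul' (huleU x) (ENNReal.ofReal_le_ofReal ?_)
        have h1 : 1 ≤ cp + u x := le_add_of_le_of_nonneg hc1 (hu0 x)
        refine rpow_le_rpow (log_nonneg h1) (log_le_log (zero_lt_one.trans_le h1) ?_) hq.le
        exact add_le_add_left hcc _
    _ = ∫⁻ x, G x * TF x ∂(gaussE d) := lintegral_gaussE_mehler_symm d hab hF hG
    _ = ∫⁻ z, TF z.1 ∂cpl := by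
        rw [← lintegral_map hTF measurable_fst, hfst,
          lintegral_withDensity_eq_lintegral_mul _ (by fun_prop) hTF]
        rfl
    _ ≤ ∫⁻ z, (ENNReal.ofReal ((3 / 2) ^ q) * ENNReal.ofReal (log (V z.2) ^ q) +
          ENNReal.ofReal (t ^ (-p / 2) * (3 / 2) ^ q) * ENNReal.ofReal (‖z.1 - z.2‖ ^ p)) ∂cpl :=
        lintegral_mono_ae (hae.mono fun z hz => hpoint z.1 z.2 hz)
    _ = ENNReal.ofReal ((3 / 2) ^ q) * ∫⁻ x, ENNReal.ofReal (log (V x) ^ q) ∂(gaussE d) +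
          ENNReal.ofReal (t ^ (-p / 2) * (3 / 2) ^ q) *
            ∫⁻ z, ENNReal.ofReal (‖z.1 - z.2‖ ^ p) ∂cpl := by
        rw [lintegral_add_left (by fun_prop), lintegral_const_mul _ (by fun_prop),
          lintegral_const_mul _ (by fun_prop),
          ← lintegral_map (f := fun y => ENNReal.ofReal (log (V y) ^ q)) (by fun_prop)
            measurable_snd, hsnd]
    _ ≤ _ := by
        gcongr
        refine (mul_le_mul_right hJensen _).trans ?_
        have hlog : 0 ≤ log (cp + 1) := log_nonneg (by linarith)
        rw [← ENNReal.ofReal_mul (by positivity)]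
        apply ENNReal.ofReal_le_ofReal
        rw [mul_rpow (by norm_num) hlog, ← mul_assoc, ← mul_rpow (by norm_num) (by norm_num)]
        gcongr
        calc (3 / 2 * 2 : ℝ) ^ q ≤ 6 ^ q := rpow_le_rpow (by norm_num) (by norm_num) hq.le
          _ ≤ 6 ^ (q + 1) := rpow_le_rpow_of_exponent_le (by norm_num) (by linarith)
end
end

section
/- Let f : ℝ^d → (0, ∞) be a C¹ function with ∫ f dγ < ∞ and ∫ (|∇f|²/f) dγ < ∞. Then for every t > 0 the function T_t f is everywhere positive and differentiable, and ∫ (|∇(T_t f)|² / (T_t f)) dγ ≤ ∫ (|∇f|²/f) dγ. -/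
open MeasureTheory Real

noncomputable section

/-- The density of `ouT` with respect to `gaussE`: the law of `a • x + s • y`, for `y` standard
Gaussian and `a ^ 2 + s ^ 2 = 1`, has density `mehlerKernel d a s x` with respect to `gaussE d`. -/
def mehlerKernel (d : ℕ) (a s : ℝ) (x z : EuclideanSpace ℝ (Fin d)) : ℝ :=
  (s ^ d)⁻¹ * Real.exp (-(a ^ 2 * ‖z‖ ^ 2 - 2 * a * inner ℝ z x + a ^ 2 * ‖x‖ ^ 2) / (2 * s ^ 2))

instance (d : ℕ) : IsProbabilityMeasure (gaussE d) where
  measure_univ := by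
    have hI : ∫ x : EuclideanSpace ℝ (Fin d),
        (2 * π) ^ (-(d : ℝ) / 2) * Real.exp (-‖x‖ ^ 2 / 2) = 1 := by
      have h := GaussianFourier.integral_rexp_neg_mul_sq_norm
        (V := EuclideanSpace ℝ (Fin d)) (b := 1 / 2) (by norm_num)
      have h2 : ∀ x : EuclideanSpace ℝ (Fin d), -‖x‖ ^ 2 / 2 = -(1 / 2) * ‖x‖ ^ 2 :=
        fun x => by ring
      simp_rw [h2]
      rw [integral_const_mul, h, finrank_euclideanSpace_fin,
        show π / (1 / 2) = 2 * π by ring, ← Real.rpow_add (by positivity)]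
      rw [show -(d : ℝ) / 2 + d / 2 = 0 by ring, Real.rpow_zero]
    rw [gaussE, withDensity_apply _ MeasurableSet.univ, Measure.restrict_univ,
      ← ofReal_integral_eq_lintegral_ofReal
        (Integrable.of_integral_ne_zero (by rw [hI]; exact one_ne_zero))
        (Filter.Eventually.of_forall fun x => by positivity), hI, ENNReal.ofReal_one]

section mehlerKernel

variable {d : ℕ} {a s : ℝ}

lemma mehlerKernel_nonneg (hs : 0 < s) (x z : EuclideanSpace ℝ (Fin d)) :
    0 ≤ mehlerKernel d a s x z := by
  unfold mehlerKernel; positivity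

lemma mehlerKernel_comm (x z : EuclideanSpace ℝ (Fin d)) :
    mehlerKernel d a s x z = mehlerKernel d a s z x := by
  unfold mehlerKernel; rw [real_inner_comm]; ring_nf

lemma continuous_mehlerKernel : Continuous (Function.uncurry (mehlerKernel d a s)) := by
  unfold mehlerKernel Function.uncurry; fun_prop

lemma mehlerKernel_le (hs : 0 < s) (has : a ^ 2 + s ^ 2 = 1) (x z : EuclideanSpace ℝ (Fin d)) :
    mehlerKernel d a s x z ≤ (s ^ d)⁻¹ * Real.exp (‖x‖ ^ 2 / 2) := by
  unfold mehlerKernel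
  refine mul_le_mul_of_nonneg_left (Real.exp_le_exp.2 ?_) (by positivity)
  rw [div_le_div_iff₀ (by positivity) (by positivity)]
  have h := norm_sub_sq_real (a • z) x
  rw [norm_smul, mul_pow, Real.norm_eq_abs, sq_abs, inner_smul_left] at h
  have h' : s ^ 2 = 1 - a ^ 2 := by linarith
  have := sq_nonneg ‖a • z - x‖
  simp only [conj_trivial] at h
  rw [h']
  nlinarith

/-- Change of variables from `y` to `z = a • x + s • y`. -/
lemma map_gaussE (hs : 0 < s) (has : a ^ 2 + s ^ 2 = 1) (x : EuclideanSpace ℝ (Fin d)) :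
    (gaussE d).map (fun y => a • x + s • y) =
      (gaussE d).withDensity fun z => ENNReal.ofReal (mehlerKernel d a s x z) := by
  set ρ : EuclideanSpace ℝ (Fin d) → ℝ :=
    fun x => (2 * π) ^ (-(d : ℝ) / 2) * Real.exp (-‖x‖ ^ 2 / 2) with hρ
  have hρm : Measurable fun x => ENNReal.ofReal (ρ x) := by fun_prop
  have hk : Measurable fun z => ENNReal.ofReal (mehlerKernel d a s x z) :=
    (continuous_mehlerKernel.comp (Continuous.prodMk_right x)).measurable.ennreal_ofReal
  refine Measure.ext_of_lintegral _ fun φ hφ => ?_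
  rw [lintegral_map hφ (by fun_prop), lintegral_withDensity_eq_lintegral_mul _ hk hφ]
  unfold gaussE
  rw [lintegral_withDensity_eq_lintegral_mul _ hρm (by fun_prop),
    lintegral_withDensity_eq_lintegral_mul _ hρm (by fun_prop)]
  set ψ : EuclideanSpace ℝ (Fin d) → ENNReal :=
    fun z => ENNReal.ofReal (ρ (s⁻¹ • (z - a • x))) * φ z with hψ
  have hψm : Measurable ψ := by fun_prop
  have h1 : ∫⁻ y, ψ (a • x + s • y) = ENNReal.ofReal (s ^ d)⁻¹ * ∫⁻ z, ψ z := by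
    have hm : Measurable fun w => ψ (a • x + w) := by fun_prop
    rw [← lintegral_map (f := fun w => ψ (a • x + w)) hm
      (measurable_const_smul s), Measure.map_addHaar_smul _ hs.ne', lintegral_smul_measure,
      lintegral_add_left_eq_self, finrank_euclideanSpace_fin, abs_of_pos (by positivity),
      smul_eq_mul]
  calc _ = ∫⁻ y, ψ (a • x + s • y) := by
        refine lintegral_congr fun y => ?_
        simp [hψ, smul_smul, hs.ne']
    _ = _ := by
        rw [h1, ← lintegral_const_mul _ hψm]
        refine lintegral_congr fun z => ?_
        simp only [hψ, Pi.mul_apply]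
        rw [← mul_assoc, ← mul_assoc, ← ENNReal.ofReal_mul (by positivity),
          ← ENNReal.ofReal_mul (by positivity)]
        congr 2
        simp only [hρ, mehlerKernel]
        have h := norm_sub_sq_real z (a • x)
        rw [norm_smul a, mul_pow, Real.norm_eq_abs, sq_abs, inner_smul_right] at h
        have : -‖s⁻¹ • (z - a • x)‖ ^ 2 / 2 = -‖z‖ ^ 2 / 2 +
            -(a ^ 2 * ‖z‖ ^ 2 - 2 * a * inner ℝ z x + a ^ 2 * ‖x‖ ^ 2) / (2 * s ^ 2) := by
          rw [norm_smul, mul_pow, h, norm_inv, inv_pow, Real.norm_eq_abs, sq_abs]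
          field_simp
          rw [show s ^ 2 = 1 - a ^ 2 by linarith]
          ring
        rw [this, Real.exp_add]
        ring

variable {F : Type*} [NormedAddCommGroup F]

lemma integrable_comp_mehler (hs : 0 < s) (has : a ^ 2 + s ^ 2 = 1)
    {g : EuclideanSpace ℝ (Fin d) → F} (hg : Integrable g (gaussE d))
    (x : EuclideanSpace ℝ (Fin d)) :
    Integrable (fun y => g (a • x + s • y)) (gaussE d) := by
  suffices h : Integrable g ((gaussE d).map fun y => a • x + s • y) from
    h.comp_measurable (by fun_prop)
  rw [map_gaussE hs has]
  refine Integrable.mono_measure (hg.smul_measure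
    (c := ENNReal.ofReal ((s ^ d)⁻¹ * Real.exp (‖x‖ ^ 2 / 2))) ENNReal.ofReal_ne_top) ?_
  rw [← withDensity_const]
  exact withDensity_mono (Filter.Eventually.of_forall fun z =>
    ENNReal.ofReal_le_ofReal (mehlerKernel_le hs has x z))

variable [NormedSpace ℝ F]

lemma integral_comp_mehler (hs : 0 < s) (has : a ^ 2 + s ^ 2 = 1)
    {g : EuclideanSpace ℝ (Fin d) → F} (hg : Continuous g)
    (x : EuclideanSpace ℝ (Fin d)) :
    ∫ y, g (a • x + s • y) ∂gaussE d = ∫ z, mehlerKernel d a s x z • g z ∂gaussE d := by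
  have hk : Measurable fun z => ENNReal.ofReal (mehlerKernel d a s x z) :=
    (continuous_mehlerKernel.comp (Continuous.prodMk_right x)).measurable.ennreal_ofReal
  rw [← integral_map (φ := fun y => a • x + s • y) (by fun_prop)
    hg.aestronglyMeasurable, map_gaussE hs has,
    integral_withDensity_eq_integral_toReal_smul hk
      (Filter.Eventually.of_forall fun _ => ENNReal.ofReal_lt_top)]
  simp_rw [ENNReal.toReal_ofReal (mehlerKernel_nonneg hs _ _)]

lemma continuous_integral_comp_mehler (hs : 0 < s) (has : a ^ 2 + s ^ 2 = 1)
    {g : EuclideanSpace ℝ (Fin d) → F} (hgc : Continuous g) (hg : Integrable g (gaussE d)) :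
    Continuous fun x => ∫ y, g (a • x + s • y) ∂gaussE d := by
  simp_rw [integral_comp_mehler hs has hgc]
  refine continuous_iff_continuousAt.2 fun x₀ => ?_
  have hk : Continuous fun p : EuclideanSpace ℝ (Fin d) × EuclideanSpace ℝ (Fin d) =>
    mehlerKernel d a s p.1 p.2 := continuous_mehlerKernel
  refine continuousAt_of_dominated
    (bound := fun z => (s ^ d)⁻¹ * Real.exp ((‖x₀‖ + 1) ^ 2 / 2) * ‖g z‖)
    (Filter.Eventually.of_forall fun x => ?_) ?_ (hg.norm.const_mul _)
    (Filter.Eventually.of_forall fun z => ?_)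
  · exact ((by fun_prop : Continuous fun z => mehlerKernel d a s x z).aestronglyMeasurable).smul
      hg.aestronglyMeasurable
  · filter_upwards [Metric.ball_mem_nhds x₀ one_pos] with x hx
    refine Filter.Eventually.of_forall fun z => ?_
    have hx' : ‖x‖ ≤ ‖x₀‖ + 1 := by
      have := norm_le_norm_add_norm_sub' x x₀
      rw [Metric.mem_ball, dist_eq_norm] at hx
      linarith
    rw [norm_smul, Real.norm_of_nonneg (mehlerKernel_nonneg hs _ _)]
    gcongr
    refine (mehlerKernel_le hs has x z).trans ?_
    gcongr
  · exact (by fun_prop : Continuous fun x => mehlerKernel d a s x z • g z).continuousAt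

/-- Invariance of the Gaussian measure under the semigroup. -/
lemma lintegral_lintegral_comp_mehler (hs : 0 < s) (has : a ^ 2 + s ^ 2 = 1)
    {φ : EuclideanSpace ℝ (Fin d) → ENNReal} (hφ : Measurable φ) :
    ∫⁻ x, ∫⁻ y, φ (a • x + s • y) ∂gaussE d ∂gaussE d = ∫⁻ z, φ z ∂gaussE d := by
  have hk : Measurable (Function.uncurry fun x z : EuclideanSpace ℝ (Fin d) =>
      ENNReal.ofReal (mehlerKernel d a s x z)) :=
    continuous_mehlerKernel.measurable.ennreal_ofReal
  have h1 (ψ : EuclideanSpace ℝ (Fin d) → ENNReal) (hψ : Measurable ψ) (x) :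
      ∫⁻ y, ψ (a • x + s • y) ∂gaussE d =
        ∫⁻ z, ENNReal.ofReal (mehlerKernel d a s x z) * ψ z ∂gaussE d := by
    rw [← lintegral_map (g := fun y => a • x + s • y) hψ (by fun_prop), map_gaussE hs has,
      lintegral_withDensity_eq_lintegral_mul _ (hk.of_uncurry_left (x := x)) hψ]
    rfl
  simp_rw [h1 φ hφ]
  rw [lintegral_lintegral_swap (by fun_prop)]
  refine lintegral_congr fun z => ?_
  rw [lintegral_mul_const _ (hk.of_uncurry_right (y := z))]
  have h2 := h1 (fun _ => 1) measurable_const z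
  simp only [mul_one, lintegral_const, measure_univ] at h2
  simp_rw [mehlerKernel_comm _ z]
  rw [← h2, one_mul]

/-- The commutation of differentiation with the semigroup. -/
lemma hasFDerivAt_integral_comp_mehler (hs : 0 < s) (has : a ^ 2 + s ^ 2 = 1)
    {f : EuclideanSpace ℝ (Fin d) → ℝ} (hf : ContDiff ℝ 1 f) (hfi : Integrable f (gaussE d))
    (hf' : Integrable (fderiv ℝ f) (gaussE d)) (x : EuclideanSpace ℝ (Fin d)) :
    HasFDerivAt (fun x => ∫ y, f (a • x + s • y) ∂gaussE d)
      (a • ∫ y, fderiv ℝ f (a • x + s • y) ∂gaussE d) x := by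
  have hf'c : Continuous (fderiv ℝ f) := hf.continuous_fderiv one_ne_zero
  set G := fun x => a • ∫ y, fderiv ℝ f (a • x + s • y) ∂gaussE d with hG
  have hGc : Continuous G := (continuous_integral_comp_mehler hs has hf'c hf').const_smul a
  have hNc := continuous_integral_comp_mehler hs has hf'c.norm hf'.norm
  have key (v : EuclideanSpace ℝ (Fin d)) :
      (∫ y, f (a • (x + v) + s • y) ∂gaussE d) - ∫ y, f (a • x + s • y) ∂gaussE d =
        ∫ r in (0 : ℝ)..1, G (x + r • v) v := by
    rw [← integral_sub (integrable_comp_mehler hs has hfi _) (integrable_comp_mehler hs has hfi _)]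
    have hline (y : EuclideanSpace ℝ (Fin d)) :
        f (a • (x + v) + s • y) - f (a • x + s • y) =
          ∫ r in (0 : ℝ)..1, fderiv ℝ f (a • (x + r • v) + s • y) (a • v) := by
      rw [intervalIntegral.integral_eq_sub_of_hasDerivAt
        (f := fun r : ℝ => f (a • (x + r • v) + s • y)) (fun r _ => ?_)
        (Continuous.intervalIntegrable (by fun_prop) _ _)]
      · simp
      · have h1 : HasDerivAt (fun r : ℝ => a • (x + r • v) + s • y) (a • v) r := by
          simpa using ((((hasDerivAt_id r).smul_const v).const_add x).const_smul a).add_const (s • y)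
        exact ((hf.differentiable one_ne_zero _).hasFDerivAt).comp_hasDerivAt r h1
    simp_rw [hline]
    rw [← intervalIntegral_integral_swap]
    · refine intervalIntegral.integral_congr fun r _ => ?_
      simp only [hG]
      rw [smul_apply,
        ContinuousLinearMap.integral_apply (integrable_comp_mehler hs has hf' (x + r • v)),
        ← integral_smul]
      simp
    · have hc : Continuous (Function.uncurry fun (r : ℝ) (y : EuclideanSpace ℝ (Fin d)) =>
          fderiv ℝ f (a • (x + r • v) + s • y) (a • v)) := by
        unfold Function.uncurry; fun_prop
      have hc' : Continuous (Function.uncurry fun (r : ℝ) (y : EuclideanSpace ℝ (Fin d)) =>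
          fderiv ℝ f (a • (x + r • v) + s • y)) := by
        unfold Function.uncurry; fun_prop
      refine Integrable.mono' (g := fun p => ‖fderiv ℝ f (a • (x + p.1 • v) + s • p.2)‖ * ‖a • v‖)
        (Integrable.mul_const (Integrable.norm ?_) _) hc.aestronglyMeasurable
        (Filter.Eventually.of_forall fun p => ContinuousLinearMap.le_opNorm _ _)
      refine (integrable_prod_iff hc'.aestronglyMeasurable).2
        ⟨Filter.Eventually.of_forall fun r => integrable_comp_mehler hs has hf' (x + r • v), ?_⟩
      refine intervalIntegrable_iff.1 (Continuous.intervalIntegrable ?_ _ _)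
      exact hNc.comp (g := fun x => ∫ y, ‖fderiv ℝ f (a • x + s • y)‖ ∂gaussE d)
        (f := fun r : ℝ => x + r • v) (by fun_prop)
  rw [hasFDerivAt_iff_isLittleO_nhds_zero, Asymptotics.isLittleO_iff]
  intro ε hε
  obtain ⟨δ, hδ, hball⟩ := Metric.continuousAt_iff.1 (hGc.continuousAt (x := x)) ε hε
  filter_upwards [Metric.ball_mem_nhds 0 hδ] with v hv
  rw [key v]
  have hint : IntervalIntegrable (fun r : ℝ => G (x + r • v) v) volume 0 1 :=
    Continuous.intervalIntegrable (by fun_prop) _ _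
  have hconst : G x v = ∫ _ in (0 : ℝ)..1, G x v := by simp
  change ‖_ - G x v‖ ≤ _
  rw [hconst, ← intervalIntegral.integral_sub hint intervalIntegrable_const]
  refine (intervalIntegral.norm_integral_le_of_norm_le_const (C := ε * ‖v‖) fun r hr => ?_).trans
    (by simp)
  rw [Set.uIoc_of_le zero_le_one] at hr
  rw [← sub_apply]
  refine (ContinuousLinearMap.le_opNorm _ _).trans ?_
  gcongr
  rw [← dist_eq_norm]
  refine (hball ?_).le
  rw [mem_ball_zero_iff] at hv
  rw [dist_eq_norm, add_sub_cancel_left, norm_smul, Real.norm_of_nonneg hr.1.le]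
  nlinarith [norm_nonneg v, hr.2]

end mehlerKernel

/-- Cauchy-Schwarz in the form `(∫ u)² / ∫ w ≤ ∫ u² / w`. -/
lemma sq_norm_integral_div_le {α F : Type*} [MeasurableSpace α] {μ : Measure α}
    [NormedAddCommGroup F] [NormedSpace ℝ F] {u : α → F} {w : α → ℝ} (hw : ∀ x, 0 < w x)
    (hwi : Integrable w μ) (hu : Integrable u μ) (hi : Integrable (fun x => ‖u x‖ ^ 2 / w x) μ)
    (hpos : 0 < ∫ x, w x ∂μ) :
    ‖∫ x, u x ∂μ‖ ^ 2 / ∫ x, w x ∂μ ≤ ∫ x, ‖u x‖ ^ 2 / w x ∂μ := by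
  set C := ∫ x, w x ∂μ
  set l := (∫ x, ‖u x‖ ∂μ) / C with hl
  have h1 : ∫ x, 2 * l * ‖u x‖ ∂μ ≤ ∫ x, (‖u x‖ ^ 2 / w x + l ^ 2 * w x) ∂μ := by
    refine integral_mono (hu.norm.const_mul _) (hi.add (hwi.const_mul _)) fun x => ?_
    have hx := hw x
    have : ‖u x‖ ^ 2 / w x + l ^ 2 * w x - 2 * l * ‖u x‖ = (‖u x‖ - l * w x) ^ 2 / w x := by
      field_simp
      ring
    have : 0 ≤ (‖u x‖ - l * w x) ^ 2 / w x := by positivity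
    dsimp only
    linarith
  rw [integral_const_mul, integral_add hi (hwi.const_mul _), integral_const_mul] at h1
  have h2 : ‖∫ x, u x ∂μ‖ ^ 2 / C ≤ (∫ x, ‖u x‖ ∂μ) ^ 2 / C := by
    gcongr
    exact norm_integral_le_integral_norm u
  have h3 : 2 * l * (∫ x, ‖u x‖ ∂μ) - l ^ 2 * C = (∫ x, ‖u x‖ ∂μ) ^ 2 / C := by
    rw [hl]; field_simp; ring
  linarith

theorem stmt9 (d : ℕ)
    (f : EuclideanSpace ℝ (Fin d) → ℝ) (hf : ContDiff ℝ 1 f) (hfpos : ∀ x, 0 < f x)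
    (hfint : Integrable f (gaussE d))
    (hfisher : Integrable (fun x => ‖gradient f x‖ ^ 2 / f x) (gaussE d)) :
    ∀ t : ℝ, 0 < t →
      (∀ x, 0 < ouT d t f x) ∧ Differentiable ℝ (ouT d t f) ∧
      ∫⁻ x, ENNReal.ofReal (‖gradient (ouT d t f) x‖ ^ 2 / ouT d t f x) ∂(gaussE d) ≤
        ENNReal.ofReal (∫ x, ‖gradient f x‖ ^ 2 / f x ∂(gaussE d)) := by
  have hnorm (g : EuclideanSpace ℝ (Fin d) → ℝ) (x) : ‖gradient g x‖ = ‖fderiv ℝ g x‖ :=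
    LinearIsometryEquiv.norm_map _ _
  simp_rw [hnorm] at hfisher ⊢
  have hf'c : Continuous (fderiv ℝ f) := hf.continuous_fderiv one_ne_zero
  have hf' : Integrable (fderiv ℝ f) (gaussE d) := by
    refine Integrable.mono' (hfisher.add hfint) hf'c.aestronglyMeasurable
      (Filter.Eventually.of_forall fun x => ?_)
    have hx := hfpos x
    have : ‖fderiv ℝ f x‖ ^ 2 / f x + f x - ‖fderiv ℝ f x‖ =
        ((‖fderiv ℝ f x‖ - f x / 2) ^ 2 + 3 / 4 * f x ^ 2) / f x := by
      field_simp
      ring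
    have : 0 ≤ ((‖fderiv ℝ f x‖ - f x / 2) ^ 2 + 3 / 4 * f x ^ 2) / f x := by positivity
    rw [Pi.add_apply]
    linarith
  intro t ht
  set a := Real.exp (-t) with ha
  set s := Real.sqrt (1 - Real.exp (-2 * t)) with hsdef
  have hexp : Real.exp (-2 * t) < 1 := Real.exp_lt_one_iff.2 (by linarith)
  have hs : 0 < s := Real.sqrt_pos.2 (by linarith)
  have has : a ^ 2 + s ^ 2 = 1 := by
    rw [hsdef, Real.sq_sqrt (by linarith), ha, ← Real.exp_nat_mul]
    push_cast
    rw [show (2 : ℝ) * -t = -2 * t by ring]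
    ring
  have hpos (x) : 0 < ouT d t f x := by
    refine (integral_pos_iff_support_of_nonneg (fun y => (hfpos _).le)
      (integrable_comp_mehler hs has hfint x)).2 ?_
    rw [Function.support_eq_univ fun y => (hfpos _).ne', measure_univ]
    exact one_pos
  have hderiv (x) : HasFDerivAt (ouT d t f) (a • ∫ y, fderiv ℝ f (a • x + s • y) ∂gaussE d) x :=
    hasFDerivAt_integral_comp_mehler hs has hf hfint hf' x
  refine ⟨hpos, fun x => (hderiv x).differentiableAt, ?_⟩
  have hhc : Continuous fun x => ‖fderiv ℝ f x‖ ^ 2 / f x :=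
    (hf'c.norm.pow 2).div hf.continuous fun x => (hfpos x).ne'
  have hh0 (x) : 0 ≤ ‖fderiv ℝ f x‖ ^ 2 / f x := div_nonneg (sq_nonneg _) (hfpos x).le
  rw [ofReal_integral_eq_lintegral_ofReal hfisher (Filter.Eventually.of_forall hh0),
    ← lintegral_lintegral_comp_mehler hs has hhc.measurable.ennreal_ofReal]
  refine lintegral_mono fun x => ?_
  have hhx := integrable_comp_mehler hs has hfisher x
  rw [← ofReal_integral_eq_lintegral_ofReal hhx (Filter.Eventually.of_forall fun y => hh0 _)]
  refine ENNReal.ofReal_le_ofReal ?_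
  rw [(hderiv x).fderiv]
  refine le_trans ?_ (sq_norm_integral_div_le (fun y => hfpos (a • x + s • y))
    (integrable_comp_mehler hs has hfint x) (integrable_comp_mehler hs has hf' x) hhx (hpos x))
  refine div_le_div_of_nonneg_right ?_ (hpos x).le
  rw [norm_smul, mul_pow, Real.norm_eq_abs, sq_abs]
  exact mul_le_of_le_one_left (sq_nonneg _) (by nlinarith)
end
end

section
/- Let d ∈ ℕ, let p ≥ 2, and let f ∈ C_c^∞(ℝ^d) be not identically zero. Then, with the convention that |f(x)|^p log|f(x)| = 0 at points where f(x) = 0, one has ∫ |f|^p log|f| dγ ≤ (p/2) · ‖∇f‖_{L^p(γ)}² · ‖f‖_{L^p(γ)}^{p−2} + ‖f‖_{L^p(γ)}^p · log ‖f‖_{L^p(γ)}, where ‖g‖_{L^p(γ)} := (∫ |g|^p dγ)^{1/p}. -/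
open MeasureTheory Real

noncomputable section

open scoped RealInnerProductSpace

namespace GaussianLogSobolev

open ProbabilityTheory

variable {d : ℕ}

/-- The density of the standard Gaussian measure with respect to Lebesgue measure. -/
def gaussDensity (x : EuclideanSpace ℝ (Fin d)) : ℝ :=
  (2 * π) ^ (-(d : ℝ) / 2) * Real.exp (-‖x‖ ^ 2 / 2)

lemma gaussDensity_nonneg (x : EuclideanSpace ℝ (Fin d)) : 0 ≤ gaussDensity x := by
  unfold gaussDensity; positivity

lemma continuous_gaussDensity : Continuous (gaussDensity (d := d)) := by
  unfold gaussDensity; fun_prop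

lemma gaussE_eq_withDensity :
    gaussE d = volume.withDensity fun x => ENNReal.ofReal (gaussDensity x) := rfl

lemma integrable_gaussDensity : Integrable (gaussDensity (d := d)) := by
  have h := (GaussianFourier.integrable_cexp_neg_mul_sq_norm_add
    (V := EuclideanSpace ℝ (Fin d)) (b := 1 / 2) (by norm_num) 0 0).norm
  refine (h.const_mul ((2 * π) ^ (-(d : ℝ) / 2))).congr (.of_forall fun x => ?_)
  simp only [gaussDensity, Complex.norm_exp]
  have h1 : (-(1 / 2) * (‖x‖ : ℂ) ^ 2 + 0 * (⟪(0 : EuclideanSpace ℝ (Fin d)), x⟫ : ℝ) : ℂ) =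
      ((-‖x‖ ^ 2 / 2 : ℝ) : ℂ) := by
    push_cast
    ring
  rw [h1, Complex.ofReal_re]

instance : IsFiniteMeasure (gaussE d) :=
  isFiniteMeasure_withDensity_ofReal integrable_gaussDensity.2

lemma integral_gaussE {F : Type*} [NormedAddCommGroup F] [NormedSpace ℝ F]
    (φ : EuclideanSpace ℝ (Fin d) → F) :
    ∫ x, φ x ∂(gaussE d) = ∫ x, gaussDensity x • φ x := by
  rw [gaussE_eq_withDensity, integral_withDensity_eq_integral_toReal_smul
    continuous_gaussDensity.measurable.ennreal_ofReal (by simp)]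
  simp [ENNReal.toReal_ofReal (gaussDensity_nonneg _)]

lemma integrable_gaussE_iff {φ : EuclideanSpace ℝ (Fin d) → ℝ} :
    Integrable φ (gaussE d) ↔ Integrable fun x => gaussDensity x * φ x := by
  rw [gaussE_eq_withDensity, integrable_withDensity_iff_integrable_smul'
    continuous_gaussDensity.measurable.ennreal_ofReal (by simp)]
  simp [ENNReal.toReal_ofReal (gaussDensity_nonneg _)]

lemma gaussE_eq_stdGaussian : gaussE d = stdGaussian (EuclideanSpace ℝ (Fin d)) := by
  refine Measure.ext_of_charFun ?_
  ext t
  rw [charFun_stdGaussian, charFun_apply, integral_gaussE]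
  have h := GaussianFourier.integral_cexp_neg_mul_sq_norm_add
    (V := EuclideanSpace ℝ (Fin d)) (b := 1 / 2) (by norm_num) Complex.I t
  have h2 : ∀ x : EuclideanSpace ℝ (Fin d),
      gaussDensity x • Complex.exp (⟪x, t⟫ * Complex.I) =
      ((2 * π) ^ (-(d : ℝ) / 2) : ℝ) *
        Complex.exp (-(1 / 2) * ‖x‖ ^ 2 + Complex.I * ⟪t, x⟫) := by
    intro x
    rw [Complex.exp_add, gaussDensity, Complex.real_smul, real_inner_comm]
    push_cast
    rw [mul_assoc]
    congr 3
    · ring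
    · ring_nf
  simp_rw [h2]
  rw [integral_const_mul, h, ← mul_assoc]
  have h3 : (((2 * π) ^ (-(d : ℝ) / 2) : ℝ) : ℂ) *
      (π / (1 / 2)) ^ ((Module.finrank ℝ (EuclideanSpace ℝ (Fin d)) : ℂ) / 2) = 1 := by
    have : ((π : ℂ) / (1 / 2)) = ((2 * π : ℝ) : ℂ) := by push_cast; ring
    rw [this, finrank_euclideanSpace_fin]
    have h4 : (((d : ℂ)) / 2) = (((d : ℝ) / 2 : ℝ) : ℂ) := by push_cast; ring
    rw [h4, ← Complex.ofReal_cpow (by positivity), ← Complex.ofReal_mul,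
      ← Real.rpow_add (by positivity)]
    simp [neg_div]
  rw [h3, one_mul, Complex.I_sq]
  congr 1
  ring

instance : IsProbabilityMeasure (gaussE d) := by
  rw [gaussE_eq_stdGaussian]; infer_instance

instance : IsGaussian (gaussE d) := by
  rw [gaussE_eq_stdGaussian]; infer_instance

lemma integrable_norm_gaussE : Integrable (fun x => ‖x‖) (gaussE d) :=
  (IsGaussian.integrable_id (μ := gaussE d)).norm

lemma map_rotation_gaussE (θ : ℝ) :
    ((gaussE d).prod (gaussE d)).map (ContinuousLinearMap.rotation θ) =
      (gaussE d).prod (gaussE d) := by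
  refine IsGaussian.map_rotation_eq_self ?_ θ
  rw [gaussE_eq_stdGaussian]
  simp

lemma hasFDerivAt_gaussDensity (x : EuclideanSpace ℝ (Fin d)) :
    HasFDerivAt gaussDensity (-gaussDensity x • innerSL ℝ x) x := by
  have h := (((hasStrictFDerivAt_norm_sq x).hasFDerivAt.neg.mul_const (1 / 2 : ℝ)).exp).const_mul
    ((2 * π) ^ (-(d : ℝ) / 2))
  convert! h using 1
  · ext y; simp [gaussDensity]; left; ring_nf
  · ext y; simp [gaussDensity]; ring_nf

/-- Stein's identity: Gaussian integration by parts. -/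
lemma integral_inner_mul_gaussE {K : EuclideanSpace ℝ (Fin d) → ℝ} {B B' : ℝ}
    (hK : Differentiable ℝ K) (hB : ∀ x, |K x| ≤ B) (hB' : ∀ x, ‖fderiv ℝ K x‖ ≤ B')
    (v : EuclideanSpace ℝ (Fin d)) :
    ∫ y, ⟪v, y⟫ * K y ∂(gaussE d) = ∫ y, fderiv ℝ K y v ∂(gaussE d) := by
  have hK0 : Integrable K (gaussE d) :=
    .of_bound hK.continuous.aestronglyMeasurable B (.of_forall hB)
  have hK1 : Integrable (fun y => fderiv ℝ K y v) (gaussE d) := by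
    refine .of_bound (measurable_fderiv_apply_const ℝ K v).aestronglyMeasurable (B' * ‖v‖)
      (.of_forall fun y => ?_)
    exact (ContinuousLinearMap.le_opNorm _ _).trans (by gcongr; exact hB' y)
  have hK2 : Integrable (fun y => ⟪v, y⟫ * K y) (gaussE d) := by
    refine (integrable_norm_gaussE.const_mul (‖v‖ * B)).mono'
      (Continuous.aestronglyMeasurable (by have := hK.continuous; fun_prop))
      (.of_forall fun y => ?_)
    rw [norm_mul, mul_right_comm]
    gcongr
    · exact norm_inner_le_norm _ _
    · exact hB y
  rw [integrable_gaussE_iff] at hK0 hK1 hK2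
  have hd : ∀ x, fderiv ℝ gaussDensity x v = -(gaussDensity x * ⟪v, x⟫) := by
    intro x
    rw [(hasFDerivAt_gaussDensity x).fderiv]
    simp [real_inner_comm]
  have := integral_mul_fderiv_eq_neg_fderiv_mul_of_integrable (μ := volume)
    (f := gaussDensity) (g := K) (v := v)
    (by refine hK2.neg.congr (.of_forall fun x => ?_); simp [hd]; ring)
    hK1 hK0 (fun x _ => (hasFDerivAt_gaussDensity x).differentiableAt) (fun x _ => hK x)
  rw [integral_gaussE, integral_gaussE]
  simp only [smul_eq_mul, this, hd, neg_mul, integral_neg, neg_neg, mul_assoc]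

/-- The Ornstein-Uhlenbeck semigroup, parametrized by an angle: the Gaussian average of
`F (cos θ • x + sin θ • y)` over `y`. -/
def rotAvg {G : Type*} [NormedAddCommGroup G] [NormedSpace ℝ G]
    (F : EuclideanSpace ℝ (Fin d) → G) (θ : ℝ) (x : EuclideanSpace ℝ (Fin d)) : G :=
  ∫ y, F (cos θ • x + sin θ • y) ∂(gaussE d)

section rotAvg

lemma integrable_comp_rot {G : Type*} [NormedAddCommGroup G] {F : EuclideanSpace ℝ (Fin d) → G} (hF : Continuous F) {C : ℝ}
    (hC : ∀ x, ‖F x‖ ≤ C) (θ : ℝ) (x : EuclideanSpace ℝ (Fin d)) [SecondCountableTopology G] :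
    Integrable (fun y => F (cos θ • x + sin θ • y)) (gaussE d) :=
  .of_bound (hF.comp (by fun_prop)).aestronglyMeasurable C (.of_forall fun _ => hC _)

variable {G : Type*} [NormedAddCommGroup G] [NormedSpace ℝ G]

lemma norm_rotAvg_le {F : EuclideanSpace ℝ (Fin d) → G} {C : ℝ} (hC : ∀ x, ‖F x‖ ≤ C)
    (θ : ℝ) (x : EuclideanSpace ℝ (Fin d)) : ‖rotAvg F θ x‖ ≤ C := by
  simpa [rotAvg] using norm_integral_le_of_norm_le_const (μ := gaussE d)
    (.of_forall fun y => hC (cos θ • x + sin θ • y))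

lemma le_rotAvg {F : EuclideanSpace ℝ (Fin d) → ℝ} (hF : Continuous F) {C ε : ℝ}
    (hC : ∀ x, ‖F x‖ ≤ C) (hε : ∀ x, ε ≤ F x) (θ : ℝ) (x : EuclideanSpace ℝ (Fin d)) :
    ε ≤ rotAvg F θ x := by
  have := integral_mono (μ := gaussE d) (integrable_const ε) (integrable_comp_rot hF hC θ x)
    (fun y => hε _)
  simpa [rotAvg] using this

lemma continuous_rotAvg {F : EuclideanSpace ℝ (Fin d) → G} (hF : Continuous F) {C : ℝ}
    (hC : ∀ x, ‖F x‖ ≤ C) (θ : ℝ) : Continuous (rotAvg F θ) := by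
  refine continuous_of_dominated (bound := fun _ => C) (fun x => ?_)
    (fun x => .of_forall fun y => hC _) (integrable_const C) (.of_forall fun y => ?_)
  · exact (hF.comp (by fun_prop)).aestronglyMeasurable
  · exact hF.comp (by fun_prop)

lemma integral_prod_rotation {Φ : EuclideanSpace ℝ (Fin d) × EuclideanSpace ℝ (Fin d) → ℝ}
    (hΦ : Continuous Φ) (θ : ℝ) :
    ∫ z, Φ (cos θ • z.1 + sin θ • z.2, -sin θ • z.1 + cos θ • z.2)
        ∂((gaussE d).prod (gaussE d)) =
      ∫ z, Φ z ∂((gaussE d).prod (gaussE d)) := by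
  conv_rhs => rw [← map_rotation_gaussE θ]
  rw [integral_map (by fun_prop) hΦ.aestronglyMeasurable]
  simp [ContinuousLinearMap.rotation_apply]

lemma integrable_prod_rotation {Φ : EuclideanSpace ℝ (Fin d) × EuclideanSpace ℝ (Fin d) → ℝ}
    (hΦ : Integrable Φ ((gaussE d).prod (gaussE d))) (θ : ℝ) :
    Integrable (fun z => Φ (cos θ • z.1 + sin θ • z.2, -sin θ • z.1 + cos θ • z.2))
      ((gaussE d).prod (gaussE d)) := by
  rw [← map_rotation_gaussE θ] at hΦ
  simpa [Function.comp_def, ContinuousLinearMap.rotation_apply] using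
    hΦ.comp_measurable (by fun_prop)

lemma integral_rotAvg {F : EuclideanSpace ℝ (Fin d) → ℝ} (hF : Continuous F) {C : ℝ}
    (hC : ∀ x, ‖F x‖ ≤ C) (θ : ℝ) :
    ∫ x, rotAvg F θ x ∂(gaussE d) = ∫ x, F x ∂(gaussE d) := by
  have h := integral_prod_rotation (d := d) (Φ := fun z => F z.1) (by fun_prop) θ
  rw [integral_fun_fst, integral_prod] at h
  · simpa [rotAvg] using h
  · exact .of_bound (hF.comp (by fun_prop)).aestronglyMeasurable C (.of_forall fun _ => hC _)

end rotAvg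

section Derivatives

variable {g : EuclideanSpace ℝ (Fin d) → ℝ}
  {V : EuclideanSpace ℝ (Fin d) → EuclideanSpace ℝ (Fin d)} {C M : ℝ}

lemma hasFDerivAt_rotAvg (hg : ∀ x, HasFDerivAt g (innerSL ℝ (V x)) x) (hV : Continuous V)
    (hC : ∀ x, ‖g x‖ ≤ C) (hM : ∀ x, ‖V x‖ ≤ M) (θ : ℝ) (x : EuclideanSpace ℝ (Fin d)) :
    HasFDerivAt (rotAvg g θ) (innerSL ℝ (cos θ • rotAvg V θ x)) x := by
  have hgc : Continuous g := continuous_iff_continuousAt.2 fun x => (hg x).continuousAt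
  have hbound : ∀ y x, ‖innerSL ℝ (cos θ • V (cos θ • x + sin θ • y))‖ ≤ M := fun y x => by
    rw [innerSL_apply_norm, norm_smul]
    exact (mul_le_of_le_one_left (norm_nonneg _) (abs_cos_le_one θ)).trans (hM _)
  have h := hasFDerivAt_integral_of_dominated_of_fderiv_le (μ := gaussE d) (x₀ := x)
    (F := fun x y => g (cos θ • x + sin θ • y))
    (F' := fun x y => innerSL ℝ (cos θ • V (cos θ • x + sin θ • y)))
    (bound := fun _ => M) Filter.univ_mem
    (.of_forall fun x => (hgc.comp (by fun_prop)).aestronglyMeasurable)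
    (integrable_comp_rot hgc hC θ x)
    (((innerSL ℝ).continuous.comp
      ((hV.comp (by fun_prop)).const_smul (cos θ))).aestronglyMeasurable)
    (.of_forall fun y x _ => hbound y x) (integrable_const M) (.of_forall fun y x _ => ?_)
  · convert! h using 1
    ext v
    have hVi := integrable_comp_rot hV hM θ x
    rw [ContinuousLinearMap.integral_apply]
    · simp only [innerSL_apply_apply, real_inner_comm v]
      simp only [real_inner_smul_right, integral_const_mul, integral_inner hVi, rotAvg]
    · exact .of_bound (((innerSL ℝ).continuous.comp
        ((hV.comp (by fun_prop)).const_smul (cos θ))).aestronglyMeasurable) M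
        (.of_forall fun y => hbound y x)
  · have h1 : HasFDerivAt (fun x : EuclideanSpace ℝ (Fin d) => cos θ • x + sin θ • y)
        (cos θ • ContinuousLinearMap.id ℝ _) x :=
      ((hasFDerivAt_id x).const_smul (cos θ)).add_const _
    convert! (hg _).comp x h1 using 1
    ext v
    simp

lemma norm_inner_rot_le (hM : ∀ x, ‖V x‖ ≤ M) (θ : ℝ) (x y : EuclideanSpace ℝ (Fin d)) :
    ‖⟪V (cos θ • x + sin θ • y), -sin θ • x + cos θ • y⟫‖ ≤ M * (‖x‖ + ‖y‖) := by
  refine (norm_inner_le_norm _ _).trans ?_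
  have hM0 : 0 ≤ M := (norm_nonneg _).trans (hM 0)
  gcongr
  · exact hM _
  · refine (norm_add_le _ _).trans (add_le_add ?_ ?_) <;> rw [norm_smul]
    · exact mul_le_of_le_one_left (norm_nonneg _) (by simpa using abs_sin_le_one θ)
    · exact mul_le_of_le_one_left (norm_nonneg _) (abs_cos_le_one θ)

lemma hasDerivAt_rotAvg (hg : ∀ x, HasFDerivAt g (innerSL ℝ (V x)) x) (hV : Continuous V)
    (hC : ∀ x, ‖g x‖ ≤ C) (hM : ∀ x, ‖V x‖ ≤ M) (θ : ℝ) (x : EuclideanSpace ℝ (Fin d)) :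
    HasDerivAt (fun θ => rotAvg g θ x)
      (∫ y, ⟪V (cos θ • x + sin θ • y), -sin θ • x + cos θ • y⟫ ∂(gaussE d)) θ := by
  have hgc : Continuous g := continuous_iff_continuousAt.2 fun x => (hg x).continuousAt
  have h := hasDerivAt_integral_of_dominated_loc_of_deriv_le (μ := gaussE d) (x₀ := θ)
    (F := fun θ y => g (cos θ • x + sin θ • y))
    (F' := fun θ y => ⟪V (cos θ • x + sin θ • y), -sin θ • x + cos θ • y⟫)
    (bound := fun y => M * (‖x‖ + ‖y‖)) Filter.univ_mem
    (.of_forall fun x => (hgc.comp (by fun_prop)).aestronglyMeasurable)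
    (integrable_comp_rot hgc hC θ x)
    (Continuous.aestronglyMeasurable ?_)
    (.of_forall fun y θ _ => norm_inner_rot_le hM θ x y)
    (((integrable_const ‖x‖).add integrable_norm_gaussE).const_mul M) (.of_forall fun y θ _ => ?_)
  · exact h.2
  · exact (hV.comp (by fun_prop)).inner (by fun_prop)
  · have h1 : HasDerivAt (fun θ : ℝ => cos θ • x + sin θ • y) (-sin θ • x + cos θ • y) θ :=
      ((hasDerivAt_cos θ).smul_const x).add ((hasDerivAt_sin θ).smul_const y)
    simpa [Function.comp_def] using (hg _).comp_hasDerivAt θ h1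

lemma abs_log_le {ε C r : ℝ} (hε : 0 < ε) (h1 : ε ≤ r) (h2 : r ≤ C) :
    |log r| ≤ |log ε| + |log C| := by
  have h3 := log_le_log hε h1
  have h4 := log_le_log (hε.trans_le h1) h2
  rw [abs_le]
  constructor
  · linarith [neg_abs_le (log ε), abs_nonneg (log C)]
  · linarith [le_abs_self (log C), abs_nonneg (log ε)]

lemma rotAvg_mem_Icc (hgc : Continuous g) {ε : ℝ} (hε : 0 < ε) (hgε : ∀ x, ε ≤ g x)
    (hgC : ∀ x, g x ≤ C) (θ : ℝ) (x : EuclideanSpace ℝ (Fin d)) :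
    rotAvg g θ x ∈ Set.Icc ε C := by
  have hC : ∀ x, ‖g x‖ ≤ C := fun x => by
    rw [norm_of_nonneg (hε.le.trans (hgε x))]; exact hgC x
  exact ⟨le_rotAvg hgc hC hgε θ x, (le_abs_self _).trans (norm_rotAvg_le hC θ x)⟩

lemma hasDerivAt_integral_rotAvg_mul_log (hg : ∀ x, HasFDerivAt g (innerSL ℝ (V x)) x)
    (hV : Continuous V) {ε : ℝ} (hε : 0 < ε) (hgε : ∀ x, ε ≤ g x)
    (hgC : ∀ x, g x ≤ C) (hM : ∀ x, ‖V x‖ ≤ M) (θ : ℝ) :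
    HasDerivAt (fun θ => ∫ x, rotAvg g θ x * log (rotAvg g θ x) ∂(gaussE d))
      (∫ x, (log (rotAvg g θ x) + 1) *
        ∫ y, ⟪V (cos θ • x + sin θ • y), -sin θ • x + cos θ • y⟫ ∂(gaussE d) ∂(gaussE d)) θ := by
  have hgc : Continuous g := continuous_iff_continuousAt.2 fun x => (hg x).continuousAt
  have hC : ∀ x, ‖g x‖ ≤ C := fun x => by
    rw [norm_of_nonneg (hε.le.trans (hgε x))]; exact hgC x
  have hP := rotAvg_mem_Icc hgc hε hgε hgC
  have hPpos : ∀ θ x, 0 < rotAvg g θ x := fun θ x => hε.trans_le (hP θ x).1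
  have hPc := continuous_rotAvg hgc hC
  have hlog : ∀ θ x, |log (rotAvg g θ x)| ≤ |log ε| + |log C| := fun θ x =>
    abs_log_le hε (hP θ x).1 (hP θ x).2
  set L := |log ε| + |log C|
  have hL0 : 0 ≤ L := by positivity
  have hC0 : 0 ≤ C := (norm_nonneg _).trans (hC 0)
  have hFc : ∀ θ, Continuous fun x => rotAvg g θ x * log (rotAvg g θ x) := fun θ =>
    (hPc θ).mul ((hPc θ).log fun x => (hPpos θ x).ne')
  refine (hasDerivAt_integral_of_dominated_loc_of_deriv_le (μ := gaussE d) (x₀ := θ)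
    (F := fun θ x => rotAvg g θ x * log (rotAvg g θ x))
    (F' := fun θ x => (log (rotAvg g θ x) + 1) *
      ∫ y, ⟪V (cos θ • x + sin θ • y), -sin θ • x + cos θ • y⟫ ∂(gaussE d))
    (bound := fun x => (L + 1) * ∫ y, M * (‖x‖ + ‖y‖) ∂(gaussE d)) Filter.univ_mem
    (.of_forall fun θ => (hFc θ).aestronglyMeasurable)
    (.of_bound (hFc θ).aestronglyMeasurable (C * L) (.of_forall fun x => ?_))
    (.mul (((hPc θ).log fun x => (hPpos θ x).ne').add continuous_const).aestronglyMeasurable ?_)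
    (.of_forall fun x θ _ => ?_) ?_ (.of_forall fun x θ _ => ?_)).2
  · rw [norm_mul]
    gcongr
    · exact norm_rotAvg_le hC θ x
    · exact hlog θ x
  · refine AEStronglyMeasurable.integral_prod_right'
      (f := fun z : EuclideanSpace ℝ (Fin d) × EuclideanSpace ℝ (Fin d) =>
        ⟪V (cos θ • z.1 + sin θ • z.2), -sin θ • z.1 + cos θ • z.2⟫)
      (Continuous.aestronglyMeasurable ?_)
    exact (hV.comp (by fun_prop)).inner (by fun_prop)
  · rw [norm_mul]
    gcongr
    · refine (norm_add_le _ _).trans ?_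
      gcongr
      · exact hlog θ x
      · simp
    · exact norm_integral_le_of_norm_le
        (((integrable_const ‖x‖).add integrable_norm_gaussE).const_mul M)
        (.of_forall fun y => norm_inner_rot_le hM θ x y)
  · simp_rw [integral_const_mul, integral_add (integrable_const _) integrable_norm_gaussE]
    refine (((integrable_norm_gaussE.add (integrable_const (∫ y, ‖y‖ ∂(gaussE d)))).const_mul
      M).const_mul (L + 1)).congr (.of_forall fun x => by simp)
  · have h1 := hasDerivAt_rotAvg hg hV hC hM θ x
    exact (hasDerivAt_mul_log (hPpos θ x).ne').comp θ h1

/-- The entropy production of the Ornstein-Uhlenbeck semigroup. -/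
lemma integral_log_mul_eq_neg_fisher (hg : ∀ x, HasFDerivAt g (innerSL ℝ (V x)) x)
    (hV : Continuous V) {ε : ℝ} (hε : 0 < ε) (hgε : ∀ x, ε ≤ g x)
    (hgC : ∀ x, g x ≤ C) (hM : ∀ x, ‖V x‖ ≤ M) (θ : ℝ) :
    ∫ x, (log (rotAvg g θ x) + 1) *
        ∫ y, ⟪V (cos θ • x + sin θ • y), -sin θ • x + cos θ • y⟫ ∂(gaussE d) ∂(gaussE d) =
      -(sin θ * cos θ) * ∫ x, ‖rotAvg V θ x‖ ^ 2 / rotAvg g θ x ∂(gaussE d) := by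
  have hgc : Continuous g := continuous_iff_continuousAt.2 fun x => (hg x).continuousAt
  have hC : ∀ x, ‖g x‖ ≤ C := fun x => by
    rw [norm_of_nonneg (hε.le.trans (hgε x))]; exact hgC x
  have hP := rotAvg_mem_Icc hgc hε hgε hgC θ
  have hPpos : ∀ x, 0 < rotAvg g θ x := fun x => hε.trans_le (hP x).1
  have hPc : Continuous (rotAvg g θ) := continuous_rotAvg hgc hC θ
  have hDc : Continuous (rotAvg V θ) := continuous_rotAvg hV hM θ
  have hD : ∀ x, ‖rotAvg V θ x‖ ≤ M := norm_rotAvg_le hM θ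
  have hM0 : 0 ≤ M := (norm_nonneg _).trans (hM 0)
  set P := rotAvg g θ with hPdef
  set D := rotAvg V θ with hDdef
  set c := cos θ with hc
  set s := sin θ with hs
  have hcs : s ^ 2 + c ^ 2 = 1 := sin_sq_add_cos_sq θ
  have habs : |c| ≤ 1 := abs_cos_le_one θ
  have habs' : |s| ≤ 1 := abs_sin_le_one θ
  set H : EuclideanSpace ℝ (Fin d) → ℝ := fun x => log (P x) + 1
  set L := |log ε| + |log C|
  have hHb : ∀ x, |H x| ≤ L + 1 := fun x => by
    refine (abs_add_le _ _).trans ?_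
    gcongr
    · exact abs_log_le hε (hP x).1 (hP x).2
    · simp
  have hHc : Continuous H := (hPc.log fun x => (hPpos x).ne').add continuous_const
  have hHd : ∀ x, HasFDerivAt H (innerSL ℝ ((c / P x) • D x)) x := fun x => by
    have h := ((hasFDerivAt_rotAvg hg hV hC hM θ x).log (hPpos x).ne').add_const 1
    convert! h using 1
    ext v
    simp [← hc, ← hPdef, ← hDdef]
    ring
  have hrot : ∀ x y : EuclideanSpace ℝ (Fin d),
      c • (c • x + s • y) - s • (-s • x + c • y) = x := fun x y => by
    have : c • (c • x + s • y) - s • (-s • x + c • y) = (s ^ 2 + c ^ 2) • x := by module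
    rw [this, hcs, one_smul]
  -- Rewrite the left-hand side as an integral over the product and rotate.
  let Φ : EuclideanSpace ℝ (Fin d) × EuclideanSpace ℝ (Fin d) → ℝ := fun z =>
    ⟪V z.1, z.2⟫ * H (c • z.1 - s • z.2)
  have hΦc : Continuous Φ := by
    have h1 : Continuous fun z : EuclideanSpace ℝ (Fin d) × EuclideanSpace ℝ (Fin d) =>
      V z.1 := hV.comp continuous_fst
    exact (h1.inner continuous_snd).mul (hHc.comp (by fun_prop))
  have hΦi : Integrable Φ ((gaussE d).prod (gaussE d)) := by
    refine ((integrable_norm_gaussE.comp_snd (gaussE d)).const_mul (M * (L + 1))).mono'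
      hΦc.aestronglyMeasurable (.of_forall fun z => ?_)
    rw [norm_mul, mul_right_comm]
    gcongr
    · exact (norm_inner_le_norm _ _).trans (by gcongr; exact hM _)
    · exact hHb _
  let Ψ : EuclideanSpace ℝ (Fin d) × EuclideanSpace ℝ (Fin d) → ℝ := fun z =>
    -s * (c / P (c • z.1 - s • z.2)) * ⟪D (c • z.1 - s • z.2), V z.1⟫
  have hΨc : Continuous Ψ := by
    have h1 : Continuous fun z : EuclideanSpace ℝ (Fin d) × EuclideanSpace ℝ (Fin d) =>
      V z.1 := hV.comp continuous_fst
    have h2 : Continuous fun z : EuclideanSpace ℝ (Fin d) × EuclideanSpace ℝ (Fin d) =>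
      D (c • z.1 - s • z.2) := hDc.comp (by fun_prop)
    have h3 : Continuous fun z : EuclideanSpace ℝ (Fin d) × EuclideanSpace ℝ (Fin d) =>
      P (c • z.1 - s • z.2) := hPc.comp (by fun_prop)
    exact (continuous_const.mul (continuous_const.div h3 fun z => (hPpos _).ne')).mul
      (h2.inner h1)
  have hcP : ∀ x, |c / P x| ≤ 1 / ε := fun x => by
    rw [abs_div, abs_of_pos (hPpos x)]
    gcongr
    exact (hP x).1
  have hΨi : Integrable Ψ ((gaussE d).prod (gaussE d)) := by
    refine .of_bound hΨc.aestronglyMeasurable (1 * (1 / ε) * (M * M)) (.of_forall fun z => ?_)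
    rw [norm_mul, norm_mul, norm_neg]
    gcongr
    · exact habs'
    · exact hcP _
    · refine (norm_inner_le_norm _ _).trans ?_
      gcongr
      · exact hD _
      · exact hM _
  have hstein : ∀ u, ∫ w, Φ (u, w) ∂(gaussE d) = ∫ w, Ψ (u, w) ∂(gaussE d) := fun u => by
    have hK : ∀ w, HasFDerivAt (fun w => H (c • u - s • w))
        (innerSL ℝ ((-s * (c / P (c • u - s • w))) • D (c • u - s • w))) w := fun w => by
      have h1 : HasFDerivAt (fun w : EuclideanSpace ℝ (Fin d) => c • u - s • w)
          (-(s • ContinuousLinearMap.id ℝ _)) w :=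
        ((hasFDerivAt_id w).const_smul s).const_sub _
      convert! (hHd _).comp w h1 using 1
      ext v
      simp [mul_assoc]
    have h2 := integral_inner_mul_gaussE (B := L + 1) (B' := 1 * (1 / ε) * M)
      (fun w => (hK w).differentiableAt) (fun w => hHb _) (fun w => ?_) (V u)
    · refine h2.trans (integral_congr_ae (.of_forall fun w => ?_))
      simp only [(hK w).fderiv]
      simp [Ψ]
    · rw [(hK w).fderiv, innerSL_apply_norm, norm_smul, norm_mul, norm_neg]
      gcongr
      · exact habs'
      · exact hcP _
      · exact hD _
  calc ∫ x, H x * ∫ y, ⟪V (c • x + s • y), -s • x + c • y⟫ ∂(gaussE d) ∂(gaussE d)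
      = ∫ x, ∫ y, Φ (c • x + s • y, -s • x + c • y) ∂(gaussE d) ∂(gaussE d) := by
        simp_rw [Φ, hrot, integral_mul_const, mul_comm]
    _ = ∫ z, Φ (c • z.1 + s • z.2, -s • z.1 + c • z.2) ∂((gaussE d).prod (gaussE d)) :=
        (integral_prod _ (integrable_prod_rotation hΦi θ)).symm
    _ = ∫ z, Φ z ∂((gaussE d).prod (gaussE d)) := integral_prod_rotation hΦc θ
    _ = ∫ u, ∫ w, Φ (u, w) ∂(gaussE d) ∂(gaussE d) := integral_prod _ hΦi
    _ = ∫ u, ∫ w, Ψ (u, w) ∂(gaussE d) ∂(gaussE d) := by simp_rw [hstein]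
    _ = ∫ z, Ψ z ∂((gaussE d).prod (gaussE d)) := (integral_prod _ hΨi).symm
    _ = ∫ z, Ψ (c • z.1 + s • z.2, -s • z.1 + c • z.2) ∂((gaussE d).prod (gaussE d)) :=
        (integral_prod_rotation hΨc θ).symm
    _ = ∫ x, ∫ y, Ψ (c • x + s • y, -s • x + c • y) ∂(gaussE d) ∂(gaussE d) :=
        integral_prod _ (integrable_prod_rotation hΨi θ)
    _ = ∫ x, -(s * c) * (‖D x‖ ^ 2 / P x) ∂(gaussE d) := by
        refine integral_congr_ae (.of_forall fun x => ?_)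
        simp only [Ψ, hrot]
        rw [integral_const_mul, integral_inner (integrable_comp_rot hV hM θ x)]
        change -s * (c / P x) * ⟪D x, D x⟫ = _
        rw [real_inner_self_eq_norm_sq]
        ring
    _ = _ := integral_const_mul _ _

lemma integral_fisher_rotAvg_le (hgc : Continuous g) (hV : Continuous V) {ε : ℝ} (hε : 0 < ε)
    (hgε : ∀ x, ε ≤ g x) (hgC : ∀ x, g x ≤ C) (hM : ∀ x, ‖V x‖ ≤ M) (θ : ℝ) :
    ∫ x, ‖rotAvg V θ x‖ ^ 2 / rotAvg g θ x ∂(gaussE d) ≤ ∫ x, ‖V x‖ ^ 2 / g x ∂(gaussE d) := by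
  have hC : ∀ x, ‖g x‖ ≤ C := fun x => by
    rw [norm_of_nonneg (hε.le.trans (hgε x))]; exact hgC x
  have hbound : ∀ {a b : ℝ}, 0 ≤ a → a ≤ M → ε ≤ b → ‖a ^ 2 / b‖ ≤ M ^ 2 / ε := by
    intro a b ha haM hb
    have : 0 < b := hε.trans_le hb
    rw [norm_of_nonneg (by positivity)]
    gcongr
  have hJc : Continuous fun x => ‖V x‖ ^ 2 / g x :=
    (hV.norm.pow 2).div hgc fun x => (hε.trans_le (hgε x)).ne'
  have hJb : ∀ x, ‖‖V x‖ ^ 2 / g x‖ ≤ M ^ 2 / ε := fun x =>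
    hbound (norm_nonneg _) (hM x) (hgε x)
  have hP := rotAvg_mem_Icc hgc hε hgε hgC θ
  rw [← integral_rotAvg hJc hJb θ]
  refine integral_mono (.of_bound (Continuous.aestronglyMeasurable ?_) (M ^ 2 / ε)
    (.of_forall fun x => hbound (norm_nonneg _) (norm_rotAvg_le hM θ x) (hP x).1))
    (.of_bound (continuous_rotAvg hJc hJb θ).aestronglyMeasurable (M ^ 2 / ε)
      (.of_forall fun x => norm_rotAvg_le hJb θ x)) fun x => ?_
  · exact ((continuous_rotAvg hV hM θ).norm.pow 2).div (continuous_rotAvg hgc hC θ)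
      fun x => (hε.trans_le (hP x).1).ne'
  · have hVi := integrable_comp_rot hV hM θ x
    have hgi := integrable_comp_rot hgc hC θ x
    have hJi := integrable_comp_rot hJc hJb θ x
    have hPx : 0 < rotAvg g θ x := hε.trans_le (hP x).1
    set m := (rotAvg g θ x)⁻¹ • rotAvg V θ x with hm
    have h1 : ∫ y, (2 * ⟪m, V (cos θ • x + sin θ • y)⟫ -
        ‖m‖ ^ 2 * g (cos θ • x + sin θ • y)) ∂(gaussE d) ≤
        rotAvg (fun x => ‖V x‖ ^ 2 / g x) θ x := by
      refine integral_mono (((hVi.const_inner m).const_mul 2).sub (hgi.const_mul _)) hJi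
        fun y => ?_
      set z := cos θ • x + sin θ • y
      have hz : 0 < g z := hε.trans_le (hgε z)
      simp only
      rw [le_div_iff₀ hz]
      have h2 := norm_sub_sq_real (V z) (g z • m)
      rw [real_inner_smul_right, norm_smul, norm_of_nonneg hz.le, real_inner_comm] at h2
      nlinarith [sq_nonneg ‖V z - g z • m‖]
    rw [integral_sub ((hVi.const_inner m).const_mul 2) (hgi.const_mul _), integral_const_mul,
      integral_const_mul, integral_inner hVi] at h1
    refine le_trans (le_of_eq ?_) h1
    change _ = 2 * ⟪m, rotAvg V θ x⟫ - ‖m‖ ^ 2 * rotAvg g θ x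
    rw [hm, real_inner_smul_left, real_inner_self_eq_norm_sq, norm_smul, norm_inv,
      norm_of_nonneg hPx.le]
    field_simp
    ring

/-- **Gaussian logarithmic Sobolev inequality** for a function bounded above and below by positive
constants, with bounded continuous gradient. -/
lemma entropy_le_fisher (hg : ∀ x, HasFDerivAt g (innerSL ℝ (V x)) x)
    (hV : Continuous V) {ε : ℝ} (hε : 0 < ε) (hgε : ∀ x, ε ≤ g x)
    (hgC : ∀ x, g x ≤ C) (hM : ∀ x, ‖V x‖ ≤ M) :
    ∫ x, g x * log (g x) ∂(gaussE d) ≤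
      1 / 2 * ∫ x, ‖V x‖ ^ 2 / g x ∂(gaussE d) +
        (∫ x, g x ∂(gaussE d)) * log (∫ x, g x ∂(gaussE d)) := by
  have hgc : Continuous g := continuous_iff_continuousAt.2 fun x => (hg x).continuousAt
  set J := ∫ x, ‖V x‖ ^ 2 / g x ∂(gaussE d)
  set ψ : ℝ → ℝ := fun θ => ∫ x, rotAvg g θ x * log (rotAvg g θ x) ∂(gaussE d) with hψ
  have hd : ∀ θ, HasDerivAt (fun θ => ψ θ + 1 / 2 * J * sin θ ^ 2)
      (-(sin θ * cos θ) * (∫ x, ‖rotAvg V θ x‖ ^ 2 / rotAvg g θ x ∂(gaussE d)) +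
        1 / 2 * J * (2 * sin θ * cos θ)) θ := fun θ => by
    have h1 := hasDerivAt_integral_rotAvg_mul_log hg hV hε hgε hgC hM θ
    rw [integral_log_mul_eq_neg_fisher hg hV hε hgε hgC hM θ] at h1
    convert! h1.add (((hasDerivAt_sin θ).pow 2).const_mul (1 / 2 * J)) using 1
    simp
  have hmono : MonotoneOn (fun θ => ψ θ + 1 / 2 * J * sin θ ^ 2) (Set.Icc 0 (π / 2)) := by
    refine monotoneOn_of_deriv_nonneg (convex_Icc _ _)
      (fun θ _ => (hd θ).continuousAt.continuousWithinAt)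
      (fun θ _ => (hd θ).differentiableAt.differentiableWithinAt) fun θ hθ => ?_
    rw [interior_Icc] at hθ
    rw [(hd θ).deriv]
    have h2 := sin_nonneg_of_mem_Icc ⟨hθ.1.le, by linarith [hθ.2, pi_pos]⟩
    have h3 := cos_nonneg_of_mem_Icc ⟨by linarith [hθ.1, pi_pos], hθ.2.le⟩
    have h4 := integral_fisher_rotAvg_le hgc hV hε hgε hgC hM θ
    nlinarith [mul_nonneg (mul_nonneg h2 h3) (sub_nonneg.2 h4)]
  have h := hmono (Set.left_mem_Icc.2 (by positivity)) (Set.right_mem_Icc.2 (by positivity))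
    (by positivity)
  have h0 : ∀ x, rotAvg g 0 x = g x := fun x => by simp [rotAvg]
  have h1 : ∀ x, rotAvg g (π / 2) x = ∫ y, g y ∂(gaussE d) := fun x => by simp [rotAvg]
  simp only [hψ, h0, h1] at h
  simp only [sin_zero, sin_pi_div_two, integral_const, probReal_univ, one_smul] at h
  linarith

end Derivatives

section Limit

open Filter Topology

lemma tendsto_integral_comp_sq_add {Q : ℝ → ℝ} (hQ : Continuous Q)
    {f R : EuclideanSpace ℝ (Fin d) → ℝ} (hf : Continuous f) (hR : Continuous R) {A B : ℝ}
    (hA : ∀ x, |f x| ≤ A) (hB : ∀ x, |R x| ≤ B) :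
    Tendsto (fun δ => ∫ x, Q (f x ^ 2 + δ) * R x ∂(gaussE d)) (𝓝[>] 0)
      (𝓝 (∫ x, Q (f x ^ 2) * R x ∂(gaussE d))) := by
  obtain ⟨q, hq⟩ := (isCompact_Icc (a := 0) (b := A ^ 2 + 1)).exists_bound_of_continuousOn
    hQ.continuousOn
  have hA0 : 0 ≤ A := (abs_nonneg _).trans (hA 0)
  have hq0 : 0 ≤ q := (norm_nonneg _).trans (hq 0 ⟨le_rfl, by positivity⟩)
  refine tendsto_integral_filter_of_dominated_convergence (fun _ => q * B) (.of_forall fun δ => ?_)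
    ?_ (integrable_const _) (.of_forall fun x => ?_)
  · exact Continuous.aestronglyMeasurable (by fun_prop)
  · filter_upwards [Ioc_mem_nhdsGT (zero_lt_one (α := ℝ))] with δ hδ
    refine .of_forall fun x => ?_
    rw [norm_mul]
    gcongr
    · refine hq _ ⟨by have := hδ.1; positivity, add_le_add ?_ hδ.2⟩
      rw [← sq_abs]
      gcongr
      exact hA x
    · exact hB x
  · have h : Continuous fun δ => Q (f x ^ 2 + δ) * R x := by fun_prop
    simpa using (h.tendsto 0).mono_left nhdsWithin_le_nhds

lemma entropy_sq_add_le {p : ℝ} (hp : 2 ≤ p) {f : EuclideanSpace ℝ (Fin d) → ℝ}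
    {W : EuclideanSpace ℝ (Fin d) → EuclideanSpace ℝ (Fin d)}
    (hf : ∀ x, HasFDerivAt f (innerSL ℝ (W x)) x) (hW : Continuous W) {A B : ℝ}
    (hA : ∀ x, |f x| ≤ A) (hB : ∀ x, ‖W x‖ ≤ B) {δ : ℝ} (hδ : 0 < δ) :
    ∫ x, (f x ^ 2 + δ) ^ (p / 2) * log ((f x ^ 2 + δ) ^ (p / 2)) ∂(gaussE d) ≤
      p ^ 2 / 2 * ∫ x, (f x ^ 2 + δ) ^ (p / 2 - 1) * ‖W x‖ ^ 2 ∂(gaussE d) +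
        (∫ x, (f x ^ 2 + δ) ^ (p / 2) ∂(gaussE d)) *
          log (∫ x, (f x ^ 2 + δ) ^ (p / 2) ∂(gaussE d)) := by
  have hfc : Continuous f := continuous_iff_continuousAt.2 fun x => (hf x).continuousAt
  have hA0 : 0 ≤ A := (abs_nonneg _).trans (hA 0)
  have hB0 : 0 ≤ B := (norm_nonneg _).trans (hB 0)
  have hw : ∀ x, 0 < f x ^ 2 + δ := fun x => by positivity
  have hwA : ∀ x, f x ^ 2 + δ ≤ A ^ 2 + δ := fun x => by
    rw [← sq_abs]
    gcongr
    exact hA x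
  have hp1 : 0 ≤ p / 2 - 1 := by linarith
  have hwp : ∀ x, (f x ^ 2 + δ) ^ (p / 2 - 1) ≤ (A ^ 2 + δ) ^ (p / 2 - 1) := fun x =>
    rpow_le_rpow (hw x).le (hwA x) hp1
  set V : EuclideanSpace ℝ (Fin d) → EuclideanSpace ℝ (Fin d) := fun x =>
    (p * (f x ^ 2 + δ) ^ (p / 2 - 1) * f x) • W x with hV
  have hrc : ∀ q : ℝ, Continuous fun x => (f x ^ 2 + δ) ^ q := fun q =>
    Continuous.rpow_const (by fun_prop) fun x => .inl (hw x).ne'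
  have hVc : Continuous V := ((continuous_const.mul (hrc _)).mul hfc).smul hW
  have hg : ∀ x, HasFDerivAt (fun x => (f x ^ 2 + δ) ^ (p / 2)) (innerSL ℝ (V x)) x := fun x => by
    have h := (((hf x).pow 2).add_const δ).rpow_const (p := p / 2) (.inl (hw x).ne')
    convert! h using 1
    ext v
    simp [hV]
    ring
  have hVM : ∀ x, ‖V x‖ ≤ p * (A ^ 2 + δ) ^ (p / 2 - 1) * A * B := fun x => by
    rw [norm_smul, norm_mul, norm_mul, norm_of_nonneg (by linarith : 0 ≤ p),
      norm_of_nonneg (rpow_nonneg (hw x).le _)]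
    have hwx := hwp x
    gcongr
    · exact hA x
    · exact hB x
  have hmain := entropy_le_fisher hg hVc (ε := δ ^ (p / 2)) (C := (A ^ 2 + δ) ^ (p / 2))
    (by positivity) (fun x => by gcongr; nlinarith [sq_nonneg (f x)])
    (fun x => rpow_le_rpow (hw x).le (hwA x) (by linarith)) hVM
  refine hmain.trans (add_le_add_left ?_ _)
  have hle : ∀ x, ‖V x‖ ^ 2 / (f x ^ 2 + δ) ^ (p / 2) ≤
      p ^ 2 * ((f x ^ 2 + δ) ^ (p / 2 - 1) * ‖W x‖ ^ 2) := fun x => by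
    have h1 : (f x ^ 2 + δ) ^ (p / 2) = (f x ^ 2 + δ) ^ (p / 2 - 1) * (f x ^ 2 + δ) := by
      rw [← rpow_add_one (hw x).ne', sub_add_cancel]
    have h2 : 0 < (f x ^ 2 + δ) ^ (p / 2 - 1) := rpow_pos_of_pos (hw x) _
    rw [h1, div_le_iff₀ (mul_pos h2 (hw x)), hV, norm_smul, mul_pow, norm_eq_abs, sq_abs]
    have h3 : 0 ≤ p ^ 2 * ((f x ^ 2 + δ) ^ (p / 2 - 1)) ^ 2 * ‖W x‖ ^ 2 * δ := by positivity
    nlinarith [h3]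
  have hint : Integrable (fun x => (f x ^ 2 + δ) ^ (p / 2 - 1) * ‖W x‖ ^ 2) (gaussE d) := by
    refine .of_bound ((hrc _).mul (hW.norm.pow 2)).aestronglyMeasurable
      ((A ^ 2 + δ) ^ (p / 2 - 1) * B ^ 2) (.of_forall fun x => ?_)
    rw [norm_of_nonneg (mul_nonneg (rpow_nonneg (hw x).le _) (by positivity))]
    have hwx := hwp x
    gcongr
    · exact hB x
  have hmono := integral_mono_of_nonneg (μ := gaussE d)
    (.of_forall fun x => div_nonneg (sq_nonneg ‖V x‖) (rpow_nonneg (hw x).le (p / 2)))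
    (hint.const_mul (p ^ 2)) (.of_forall hle)
  rw [integral_const_mul] at hmono
  linarith

lemma entropy_rpow_abs_le {p : ℝ} (hp : 2 ≤ p) {f : EuclideanSpace ℝ (Fin d) → ℝ}
    {W : EuclideanSpace ℝ (Fin d) → EuclideanSpace ℝ (Fin d)}
    (hf : ∀ x, HasFDerivAt f (innerSL ℝ (W x)) x) (hW : Continuous W) {A B : ℝ}
    (hA : ∀ x, |f x| ≤ A) (hB : ∀ x, ‖W x‖ ≤ B) :
    p * ∫ x, |f x| ^ p * log |f x| ∂(gaussE d) ≤
      p ^ 2 / 2 * ∫ x, |f x| ^ (p - 2) * ‖W x‖ ^ 2 ∂(gaussE d) +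
        (∫ x, |f x| ^ p ∂(gaussE d)) * log (∫ x, |f x| ^ p ∂(gaussE d)) := by
  have hfc : Continuous f := continuous_iff_continuousAt.2 fun x => (hf x).continuousAt
  have hsq : ∀ x (q : ℝ), (f x ^ 2) ^ q = |f x| ^ (2 * q) := fun x q => by
    rw [← sq_abs, ← rpow_natCast_mul (abs_nonneg _)]
    norm_num
  have hp1 : 0 ≤ p / 2 := by linarith
  have hp2 : 0 ≤ p / 2 - 1 := by linarith
  have hone : ∀ x : EuclideanSpace ℝ (Fin d), |(1 : ℝ)| ≤ 1 := by simp
  have t1 := tendsto_integral_comp_sq_add (Q := fun r => r ^ (p / 2) * log (r ^ (p / 2)))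
    (R := fun _ => 1) (continuous_mul_log.comp (continuous_rpow_const hp1)) hfc continuous_const
    hA hone
  have t2 := tendsto_integral_comp_sq_add (Q := fun r => r ^ (p / 2 - 1))
    (R := fun x => ‖W x‖ ^ 2) (continuous_rpow_const hp2) hfc (hW.norm.pow 2)
    hA (B := B ^ 2) (fun x => by rw [abs_of_nonneg (by positivity)]; gcongr; exact hB x)
  have t3 := tendsto_integral_comp_sq_add (Q := fun r => r ^ (p / 2))
    (R := fun _ => 1) (continuous_rpow_const hp1) hfc continuous_const hA hone
  simp only [mul_one] at t1 t3
  have h := le_of_tendsto_of_tendsto t1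
    ((t2.const_mul (p ^ 2 / 2)).add ((continuous_mul_log.tendsto _).comp t3))
    (eventually_mem_nhdsWithin.mono fun δ hδ => entropy_sq_add_le hp hf hW hA hB hδ)
  have e1 : 2 * (p / 2) = p := by ring
  have e2 : 2 * (p / 2 - 1) = p - 2 := by ring
  simp only [hsq, e1, e2] at h
  refine le_trans (le_of_eq ?_) h
  rw [← integral_const_mul]
  refine integral_congr_ae (.of_forall fun x => ?_)
  rcases eq_or_ne (f x) 0 with h0 | h0
  · simp [h0, zero_rpow (by linarith : p ≠ 0)]
  · simp only
    rw [log_rpow (abs_pos.2 h0)]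
    ring

lemma integral_rpow_mul_sq_le {p : ℝ} (hp : 2 ≤ p) {f : EuclideanSpace ℝ (Fin d) → ℝ}
    {w : EuclideanSpace ℝ (Fin d) → ℝ} (hf : Continuous f) (hw : Continuous w) {A B : ℝ}
    (hf0 : ∀ x, 0 ≤ f x) (hw0 : ∀ x, 0 ≤ w x) (hA : ∀ x, f x ≤ A) (hB : ∀ x, w x ≤ B) :
    ∫ x, f x ^ (p - 2) * w x ^ 2 ∂(gaussE d) ≤
      ((∫ x, f x ^ p ∂(gaussE d)) ^ (1 / p)) ^ (p - 2) *
        ((∫ x, w x ^ p ∂(gaussE d)) ^ (1 / p)) ^ 2 := by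
  have hIf : 0 ≤ ∫ x, f x ^ p ∂(gaussE d) := integral_nonneg fun x => rpow_nonneg (hf0 x) _
  have hIw : 0 ≤ ∫ x, w x ^ p ∂(gaussE d) := integral_nonneg fun x => rpow_nonneg (hw0 x) _
  rcases hp.eq_or_lt with rfl | hp2
  · rw [← rpow_mul_natCast hIw]
    simp
  · have hconj : (p / (p - 2)).HolderConjugate (p / 2) := by
      rw [Real.holderConjugate_iff]
      refine ⟨?_, ?_⟩
      · rw [one_lt_div (by linarith)]; linarith
      · field_simp
        ring
    have h := integral_mul_le_Lp_mul_Lq_of_nonneg (μ := gaussE d) hconj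
      (f := fun x => f x ^ (p - 2)) (g := fun x => w x ^ 2)
      (.of_forall fun x => rpow_nonneg (hf0 x) _) (.of_forall fun x => sq_nonneg _)
      (.of_bound (hf.rpow_const fun x => .inr (by linarith)).aestronglyMeasurable (A ^ (p - 2))
        (.of_forall fun x => ?_))
      (.of_bound (hw.pow 2).aestronglyMeasurable (B ^ 2) (.of_forall fun x => ?_))
    · have e1 : ∀ x, (f x ^ (p - 2)) ^ (p / (p - 2)) = f x ^ p := fun x => by
        rw [← rpow_mul (hf0 x), mul_div_cancel₀ _ (by linarith)]
      have e2 : ∀ x, (w x ^ 2) ^ (p / 2) = w x ^ p := fun x => by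
        rw [← rpow_natCast_mul (hw0 x)]
        congr 1
        push_cast
        ring
      simp only [e1, e2] at h
      refine h.trans_eq ?_
      rw [← rpow_mul hIf, ← rpow_mul_natCast hIw]
      congr 2
      · field_simp
      · push_cast
        field_simp
    · rw [norm_of_nonneg (rpow_nonneg (hf0 x) _)]
      exact rpow_le_rpow (hf0 x) (hA x) (by linarith)
    · rw [norm_of_nonneg (sq_nonneg _)]
      exact pow_le_pow_left₀ (hw0 x) (hB x) 2

end Limit

end GaussianLogSobolev

/- Note: in Lean, `Real.log 0 = 0`, so the expression `|f x| ^ p * Real.log |f x|`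
automatically vanishes at points where `f x = 0`, in accordance with the stated
convention. -/
theorem stmt11 (d : ℕ) (p : ℝ) (hp : 2 ≤ p)
    (f : EuclideanSpace ℝ (Fin d) → ℝ) (hf : ContDiff ℝ (⊤ : ℕ∞) f) (hfc : HasCompactSupport f)
    (hfne : f ≠ 0)
    (Nf Ng : ℝ)
    (hNf : Nf = (∫ x, |f x| ^ p ∂(gaussE d)) ^ (1 / p))
    (hNg : Ng = (∫ x, ‖gradient f x‖ ^ p ∂(gaussE d)) ^ (1 / p)) :
    ∫ x, |f x| ^ p * Real.log |f x| ∂(gaussE d) ≤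
      p / 2 * Ng ^ 2 * Nf ^ (p - 2) + Nf ^ p * Real.log Nf := by
  have hfd : ∀ x, HasFDerivAt f (innerSL ℝ (gradient f x)) x := fun x => by
    convert! ((hf.differentiable (by simp)) x).hasGradientAt.hasFDerivAt using 1
  have hgc : Continuous (gradient f) :=
    (InnerProductSpace.toDual ℝ _).symm.continuous.comp (hf.continuous_fderiv (by simp))
  obtain ⟨A, hA⟩ := hfc.exists_bound_of_continuous hf.continuous
  obtain ⟨B, hB⟩ := (hfc.fderiv ℝ).exists_bound_of_continuous (hf.continuous_fderiv (by simp))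
  have hB' : ∀ x, ‖gradient f x‖ ≤ B := fun x => by
    simpa [gradient] using hB x
  have h1 := GaussianLogSobolev.entropy_rpow_abs_le hp hfd hgc hA hB'
  have h2 := GaussianLogSobolev.integral_rpow_mul_sq_le hp hf.continuous.abs hgc.norm
    (fun x => abs_nonneg _) (fun x => norm_nonneg _) hA hB'
  rw [← hNf, ← hNg] at h2
  set I := ∫ x, |f x| ^ p ∂(gaussE d)
  have hI0 : 0 ≤ I := integral_nonneg fun x => by positivity
  have hNp : Nf ^ p = I := by
    rw [hNf, ← rpow_mul hI0, one_div_mul_cancel (by linarith), rpow_one]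
  have hlog : I * Real.log I = p * (Nf ^ p * Real.log Nf) := by
    rw [hNp]
    rcases hI0.eq_or_lt with h0 | h0
    · simp [← h0]
    · rw [hNf, log_rpow h0]
      field_simp
  rw [hlog] at h1
  have hp0 : 0 < p := by linarith
  refine le_of_mul_le_mul_left (h1.trans ?_) hp0
  nlinarith [mul_le_mul_of_nonneg_left h2 (by positivity : 0 ≤ p ^ 2 / 2)]
end
end

section
/- For every d ∈ ℕ, every p ∈ (1, ∞) and every ε > 0 there exists a constant C > 0 such that for every C¹ function f : ℝ^d → ℝ with ∫ |f|^p dγ < ∞ and ∫ |∇f|^p dγ < ∞ one has (∫ |f|^p dγ)^{1/p} ≤ ε (∫ |∇f|^p dγ)^{1/p} + C ∫ |f| dγ. -/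
open MeasureTheory Real

noncomputable section

open scoped ENNReal

theorem rpow_lintegral_le_lintegral_rpow {α : Type*} [MeasurableSpace α] {μ : Measure α}
    [IsProbabilityMeasure μ] {g : α → ℝ≥0∞} (hg : AEMeasurable g μ) {p : ℝ} (hp : 1 ≤ p) :
    (∫⁻ a, g a ∂μ) ^ p ≤ ∫⁻ a, g a ^ p ∂μ := by
  have h := eLpNorm'_le_eLpNorm'_of_exponent_le one_pos hp μ hg.aestronglyMeasurable
  simp only [eLpNorm', enorm_eq_self, ENNReal.rpow_one, div_one] at h
  calc (∫⁻ a, g a ∂μ) ^ p ≤ ((∫⁻ a, g a ^ p ∂μ) ^ (1 / p)) ^ p := by gcongr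
    _ = _ := by rw [← ENNReal.rpow_mul, one_div_mul_cancel (by positivity), ENNReal.rpow_one]

theorem setLIntegral_comp_sub_withDensity_le {E : Type*} [NormedAddCommGroup E]
    [MeasurableSpace E] [BorelSpace E] {μ : Measure E} [μ.IsAddHaarMeasure] {ρ : E → ℝ≥0∞}
    (hρ : Measurable ρ) {F : E → ℝ≥0∞}
    (hF : Measurable F) {S : Set E} (hS : MeasurableSet S) {v : E} {K : ℝ≥0∞}
    (h : ∀ x ∈ S, ρ x ≤ K * ρ (x - v)) :
    ∫⁻ x in S, F (x - v) ∂(μ.withDensity ρ) ≤ K * ∫⁻ x, F x ∂(μ.withDensity ρ) := by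
  rw [setLIntegral_withDensity_eq_setLIntegral_mul _ hρ (by fun_prop) hS,
    lintegral_withDensity_eq_lintegral_mul _ hρ hF]
  calc ∫⁻ x in S, (ρ * fun x => F (x - v)) x ∂μ
      ≤ ∫⁻ x in S, K * (ρ * F) (x - v) ∂μ := by
        refine setLIntegral_mono (by fun_prop) fun x hx => ?_
        simp only [Pi.mul_apply]
        rw [← mul_assoc]
        gcongr
        exact h x hx
    _ ≤ ∫⁻ x, K * (ρ * F) (x - v) ∂μ := setLIntegral_le_lintegral _ _
    _ = K * ∫⁻ x, (ρ * F) x ∂μ := by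
        rw [lintegral_const_mul _ (by fun_prop), lintegral_sub_right_eq_self]

section Translation

variable {E : Type*} [NormedAddCommGroup E] [NormedSpace ℝ E]

theorem enorm_sub_le_lintegral_enorm_fderiv {f : E → ℝ} (hf : ContDiff ℝ 1 f) (x v : E) :
    ‖f x - f (x - v)‖ₑ ≤
      ∫⁻ s in Set.Ioc (0 : ℝ) 1, ‖fderiv ℝ f (x - s • v)‖ₑ * ‖v‖ₑ := by
  have hd : ∀ s : ℝ, HasDerivAt (fun s : ℝ => f (x - s • v)) (fderiv ℝ f (x - s • v) (-v)) s := by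
    intro s
    have h1 : HasDerivAt (fun s : ℝ => x - s • v) (-v) s := by
      simpa using ((hasDerivAt_id s).smul_const v).const_sub x
    exact ((hf.differentiable one_ne_zero) _).hasFDerivAt.comp_hasDerivAt s h1
  have hcont : Continuous fun s : ℝ => fderiv ℝ f (x - s • v) (-v) := by
    have := hf.continuous_fderiv one_ne_zero
    fun_prop
  have h := intervalIntegral.integral_eq_sub_of_hasDerivAt (a := 0) (b := 1) (fun s _ => hd s)
    (hcont.intervalIntegrable _ _)
  simp only [one_smul, zero_smul, sub_zero] at h
  rw [← enorm_neg, neg_sub, ← h, intervalIntegral.integral_of_le zero_le_one]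
  refine (enorm_integral_le_lintegral_enorm _).trans (lintegral_mono fun s => ?_)
  simpa using (fderiv ℝ f (x - s • v)).le_opENorm (-v)

variable [MeasurableSpace E] [BorelSpace E]
  {μ : Measure E} [μ.IsAddHaarMeasure] {ρ : E → ℝ≥0∞}

theorem setLIntegral_enorm_sub_rpow_withDensity_le [SFinite (μ.withDensity ρ)]
    (hρ : Measurable ρ) {f : E → ℝ} (hf : ContDiff ℝ 1 f)
    {p : ℝ} (hp : 1 ≤ p) {S : Set E} (hS : MeasurableSet S) {v : E} {K : ℝ≥0∞}
    (h : ∀ x ∈ S, ∀ s ∈ Set.Ioc (0 : ℝ) 1, ρ x ≤ K * ρ (x - s • v)) :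
    ∫⁻ x in S, ‖f x - f (x - v)‖ₑ ^ p ∂(μ.withDensity ρ) ≤
      K * ‖v‖ₑ ^ p * ∫⁻ x, ‖fderiv ℝ f x‖ₑ ^ p ∂(μ.withDensity ρ) := by
  have hc := hf.continuous_fderiv one_ne_zero
  have : IsProbabilityMeasure (volume.restrict (Set.Ioc (0 : ℝ) 1)) := ⟨by simp⟩
  calc ∫⁻ x in S, ‖f x - f (x - v)‖ₑ ^ p ∂(μ.withDensity ρ)
      ≤ ∫⁻ x in S, (∫⁻ s in Set.Ioc (0 : ℝ) 1, ‖fderiv ℝ f (x - s • v)‖ₑ ^ p * ‖v‖ₑ ^ p)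
          ∂(μ.withDensity ρ) := by
        refine lintegral_mono fun x => ?_
        refine (ENNReal.rpow_le_rpow (enorm_sub_le_lintegral_enorm_fderiv hf x v)
          (by positivity)).trans ?_
        refine (rpow_lintegral_le_lintegral_rpow (Measurable.aemeasurable ?_) hp).trans_eq ?_
        · exact (Continuous.measurable (by fun_prop)).mul_const _
        · simp_rw [ENNReal.mul_rpow_of_nonneg _ _ (zero_le_one.trans hp)]
    _ = ∫⁻ s in Set.Ioc (0 : ℝ) 1, ∫⁻ x in S, ‖fderiv ℝ f (x - s • v)‖ₑ ^ p * ‖v‖ₑ ^ p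
          ∂(μ.withDensity ρ) := by
        refine lintegral_lintegral_swap (Measurable.aemeasurable ?_)
        refine Measurable.mul_const (Measurable.pow_const ?_ _) _
        exact Continuous.measurable (by fun_prop)
    _ ≤ ∫⁻ s in Set.Ioc (0 : ℝ) 1, K * ‖v‖ₑ ^ p * ∫⁻ x, ‖fderiv ℝ f x‖ₑ ^ p
          ∂(μ.withDensity ρ) := by
        refine setLIntegral_mono measurable_const fun s hs => ?_
        have hm : Measurable fun x => ‖fderiv ℝ f x‖ₑ ^ p :=
          Measurable.pow_const (Continuous.measurable (by fun_prop)) _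
        have hm' : Measurable fun x => ‖fderiv ℝ f (x - s • v)‖ₑ ^ p :=
          hm.comp (measurable_id.sub_const _)
        rw [lintegral_mul_const _ hm', mul_right_comm]
        gcongr
        exact setLIntegral_comp_sub_withDensity_le hρ hm hS fun x hx => h x hx s hs
    _ = _ := by simp

theorem setLIntegral_enorm_rpow_withDensity_le_of_comparable [FiniteDimensional ℝ E]
    [IsFiniteMeasure (μ.withDensity ρ)]
    (hρ : Measurable ρ) {f : E → ℝ} (hf : ContDiff ℝ 1 f)
    {p : ℝ} (hp : 1 ≤ p) {S : Set E} (hS : MeasurableSet S) {h : ℝ} (hh : 0 < h) {K C : ℝ≥0∞}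
    (hK : ∀ x ∈ S, ∀ z, ‖z‖ ≤ h → ρ x ≤ K * ρ (x - z))
    (hC : ∀ x ∈ S, ∀ z, ‖z‖ ≤ h → 1 ≤ C * ρ (x - z)) :
    ∫⁻ x in S, ‖f x‖ₑ ^ p ∂(μ.withDensity ρ) ≤
      2 ^ (p - 1) * (K * ENNReal.ofReal h ^ p * ∫⁻ x, ‖fderiv ℝ f x‖ₑ ^ p ∂(μ.withDensity ρ) +
        ((μ (Metric.closedBall 0 h))⁻¹ * (C * ∫⁻ x, ‖f x‖ₑ ∂(μ.withDensity ρ))) ^ p *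
          μ.withDensity ρ S) := by
  have hp0 : 0 ≤ p := zero_le_one.trans hp
  have hfc : Continuous f := hf.continuous
  set B : Set E := Metric.closedBall 0 h with hB
  have hBm : MeasurableSet B := Metric.isClosed_closedBall.measurableSet
  have hB0 : μ B ≠ 0 := (Metric.measure_closedBall_pos μ _ hh).ne'
  have hBt : μ B ≠ ∞ := measure_closedBall_lt_top.ne
  set ν : Measure E := (μ B)⁻¹ • μ.restrict B with hν
  have : IsProbabilityMeasure ν := ⟨by simp [hν, ENNReal.inv_mul_cancel hB0 hBt]⟩
  set N := ∫⁻ x, ‖f x‖ₑ ∂(μ.withDensity ρ) with hN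
  have hNe : N = ∫⁻ x, (ρ * fun x => ‖f x‖ₑ) x ∂μ :=
    lintegral_withDensity_eq_lintegral_mul _ hρ (by fun_prop)
  have havg : ∀ x ∈ S, ∫⁻ z, ‖f (x - z)‖ₑ ∂ν ≤ (μ B)⁻¹ * (C * N) := by
    intro x hx
    rw [hν, lintegral_smul_measure, smul_eq_mul]
    gcongr
    calc ∫⁻ z in B, ‖f (x - z)‖ₑ ∂μ ≤ ∫⁻ z in B, C * (ρ * fun x => ‖f x‖ₑ) (x - z) ∂μ := by
          refine setLIntegral_mono' hBm fun z hz => ?_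
          simp only [Pi.mul_apply]
          rw [← mul_assoc]
          exact le_mul_of_one_le_left' (hC x hx z (by simpa [hB] using hz))
      _ ≤ ∫⁻ z, C * (ρ * fun x => ‖f x‖ₑ) (x - z) ∂μ := setLIntegral_le_lintegral _ _
      _ = C * N := by
          rw [lintegral_const_mul _ (by fun_prop), hNe,
            lintegral_sub_left_eq_self (fun y => (ρ * fun x => ‖f x‖ₑ) y) x]
  have hpt : ∀ x ∈ S, ‖f x‖ₑ ^ p ≤
      2 ^ (p - 1) * (∫⁻ z, ‖f x - f (x - z)‖ₑ ^ p ∂ν + ((μ B)⁻¹ * (C * N)) ^ p) := by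
    intro x hx
    calc ‖f x‖ₑ ^ p ≤ (∫⁻ z, ‖f x - f (x - z)‖ₑ ∂ν + ∫⁻ z, ‖f (x - z)‖ₑ ∂ν) ^ p := by
          have hm : Measurable fun z => ‖f x - f (x - z)‖ₑ := Continuous.measurable (by fun_prop)
          rw [← lintegral_add_left hm]
          refine ENNReal.rpow_le_rpow ?_ hp0
          calc ‖f x‖ₑ = ∫⁻ _, ‖f x‖ₑ ∂ν := by simp
            _ ≤ _ := lintegral_mono fun z => by
              simpa using enorm_add_le (f x - f (x - z)) (f (x - z))
      _ ≤ _ := ENNReal.rpow_add_le_mul_rpow_add_rpow _ _ hp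
      _ ≤ _ := by
          gcongr
          · exact rpow_lintegral_le_lintegral_rpow (by fun_prop) hp
          · exact havg x hx
  have hmeas : Measurable fun q : E × E => ‖f q.1 - f (q.1 - q.2)‖ₑ ^ p :=
    Measurable.pow_const (Continuous.measurable (by fun_prop)) _
  calc ∫⁻ x in S, ‖f x‖ₑ ^ p ∂(μ.withDensity ρ)
      ≤ ∫⁻ x in S, 2 ^ (p - 1) * (∫⁻ z, ‖f x - f (x - z)‖ₑ ^ p ∂ν + ((μ B)⁻¹ * (C * N)) ^ p)
          ∂(μ.withDensity ρ) := setLIntegral_mono' hS hpt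
    _ = 2 ^ (p - 1) * (∫⁻ x in S, ∫⁻ z, ‖f x - f (x - z)‖ₑ ^ p ∂ν ∂(μ.withDensity ρ) +
          ((μ B)⁻¹ * (C * N)) ^ p * μ.withDensity ρ S) := by
        rw [lintegral_const_mul _ (hmeas.lintegral_prod_right'.add_const _),
          lintegral_add_right _ measurable_const]
        simp
    _ ≤ _ := by
        gcongr
        rw [lintegral_lintegral_swap hmeas.aemeasurable, hν, lintegral_smul_measure, smul_eq_mul]
        rw [ENNReal.inv_mul_le_iff hB0 hBt]
        refine (setLIntegral_mono' (g := fun _ => K * ENNReal.ofReal h ^ p *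
          ∫⁻ x, ‖fderiv ℝ f x‖ₑ ^ p ∂(μ.withDensity ρ)) hBm fun z hz => ?_).trans_eq ?_
        · have hz : ‖z‖ ≤ h := by simpa [hB] using hz
          refine (setLIntegral_enorm_sub_rpow_withDensity_le hρ hf hp hS (v := z) (K := K)
            fun x hx s hs => hK x hx _ ?_).trans ?_
          · rw [norm_smul, Real.norm_of_nonneg hs.1.le]
            exact (mul_le_of_le_one_left (norm_nonneg _) hs.2).trans hz
          · gcongr
            rw [← ofReal_norm]
            gcongr
        · simp [mul_comm]

end Translation

section Gaussian

variable {d : ℕ}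

/-- The density of the standard Gaussian measure. -/
def gaussDensity (d : ℕ) (x : EuclideanSpace ℝ (Fin d)) : ℝ≥0∞ :=
  ENNReal.ofReal ((2 * π) ^ (-(d : ℝ) / 2) * Real.exp (-‖x‖ ^ 2 / 2))

theorem gaussE_eq_withDensity : gaussE d = volume.withDensity (gaussDensity d) := rfl

theorem measurable_gaussDensity : Measurable (gaussDensity d) := by
  unfold gaussDensity
  fun_prop

instance isFiniteMeasure_gaussE : IsFiniteMeasure (gaussE d) := by
  refine isFiniteMeasure_withDensity_ofReal (Integrable.hasFiniteIntegral ?_)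
  refine Integrable.const_mul ?_ _
  have := (GaussianFourier.integrable_cexp_neg_mul_sq_norm_add (V := EuclideanSpace ℝ (Fin d))
    (b := 1 / 2) (by norm_num) 0 0).norm
  refine this.congr (.of_forall fun x => ?_)
  simp only [Complex.norm_exp]
  congr 1
  simp [← Complex.ofReal_pow]
  ring

theorem gaussDensity_le_mul {x v : EuclideanSpace ℝ (Fin d)} {c : ℝ}
    (h : ‖x - v‖ ^ 2 - ‖x‖ ^ 2 ≤ 2 * c) :
    gaussDensity d x ≤ ENNReal.ofReal (exp c) * gaussDensity d (x - v) := by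
  unfold gaussDensity
  rw [← ENNReal.ofReal_mul (exp_pos _).le, mul_left_comm, ← exp_add]
  gcongr
  linarith

theorem one_le_mul_gaussDensity {x : EuclideanSpace ℝ (Fin d)} {M : ℝ} (h : ‖x‖ ≤ M) :
    1 ≤ ENNReal.ofReal ((2 * π) ^ ((d : ℝ) / 2) * exp (M ^ 2 / 2)) * gaussDensity d x := by
  unfold gaussDensity
  rw [← ENNReal.ofReal_mul (by positivity), ENNReal.one_le_ofReal, mul_mul_mul_comm,
    ← rpow_add (by positivity), ← exp_add, neg_div, add_neg_cancel, rpow_zero, one_mul,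
    one_le_exp_iff]
  have := pow_le_pow_left₀ (norm_nonneg x) h 2
  linarith

theorem setLIntegral_halfSpace_gaussE_le {f : EuclideanSpace ℝ (Fin d) → ℝ}
    (hf : ContDiff ℝ 1 f) {p : ℝ} (hp : 1 ≤ p)
    {e : EuclideanSpace ℝ (Fin d)} (he : ‖e‖ = 1) {h R : ℝ} (hh : 0 < h) (hR : h ≤ R) :
    ∫⁻ x in {x | R ≤ inner ℝ x e}, ‖f x‖ₑ ^ p ∂(gaussE d) ≤
      2 ^ (p - 1) * (ENNReal.ofReal h ^ p * ∫⁻ x, ‖fderiv ℝ f x‖ₑ ^ p ∂(gaussE d) +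
        ENNReal.ofReal (exp (h ^ 2 / 2 - h * R)) * ∫⁻ x, ‖f x‖ₑ ^ p ∂(gaussE d)) := by
  have hfc : Continuous f := hf.continuous
  set S : Set (EuclideanSpace ℝ (Fin d)) := {x | R ≤ inner ℝ x e} with hSdef
  have hS : MeasurableSet S := measurableSet_le measurable_const (by fun_prop)
  have hsq : ∀ (x : EuclideanSpace ℝ (Fin d)) (t : ℝ),
      ‖x - t • e‖ ^ 2 - ‖x‖ ^ 2 = t ^ 2 - 2 * t * inner ℝ x e := by
    intro x t
    rw [norm_sub_sq_real, norm_smul, he, inner_smul_right, mul_one, Real.norm_eq_abs, sq_abs]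
    ring
  have h1 := setLIntegral_enorm_sub_rpow_withDensity_le (μ := volume) (v := h • e) (K := 1)
    measurable_gaussDensity hf hp hS (by
      intro x hx s hs
      have := gaussDensity_le_mul (x := x) (v := s • h • e) (c := 0) (by
        rw [smul_smul, hsq]
        have hx : R ≤ inner ℝ x e := hx
        have h2 : s * h ≤ inner ℝ x e :=
          (mul_le_of_le_one_left hh.le hs.2).trans (hR.trans hx)
        nlinarith [mul_pos hs.1 hh])
      simpa using this)
  have h2 := setLIntegral_comp_sub_withDensity_le (μ := volume) (v := h • e)
    (K := ENNReal.ofReal (exp (h ^ 2 / 2 - h * R))) measurable_gaussDensity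
    (F := fun x => ‖f x‖ₑ ^ p) (Measurable.pow_const (Continuous.measurable (by fun_prop)) _) hS
    (by
      intro x hx
      apply gaussDensity_le_mul
      rw [hsq]
      have hx : R ≤ inner ℝ x e := hx
      nlinarith)
  rw [← gaussE_eq_withDensity] at h1 h2
  have hv : ‖h • e‖ₑ = ENNReal.ofReal h := by
    rw [← ofReal_norm, norm_smul, he, mul_one, Real.norm_of_nonneg hh.le]
  rw [one_mul, hv] at h1
  calc ∫⁻ x in S, ‖f x‖ₑ ^ p ∂(gaussE d)
      ≤ ∫⁻ x in S, 2 ^ (p - 1) * (‖f x - f (x - h • e)‖ₑ ^ p + ‖f (x - h • e)‖ₑ ^ p)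
          ∂(gaussE d) := by
        refine lintegral_mono fun x => ?_
        refine le_trans ?_ (ENNReal.rpow_add_le_mul_rpow_add_rpow _ _ hp)
        refine ENNReal.rpow_le_rpow ?_ (by positivity)
        simpa using enorm_add_le (f x - f (x - h • e)) (f (x - h • e))
    _ = 2 ^ (p - 1) * (∫⁻ x in S, ‖f x - f (x - h • e)‖ₑ ^ p ∂(gaussE d) +
          ∫⁻ x in S, ‖f (x - h • e)‖ₑ ^ p ∂(gaussE d)) := by
        have hm : Measurable fun x => ‖f x - f (x - h • e)‖ₑ ^ p :=
          Measurable.pow_const (Continuous.measurable (by fun_prop)) _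
        have hm' : Measurable fun x => ‖f (x - h • e)‖ₑ ^ p :=
          Measurable.pow_const (Continuous.measurable (by fun_prop)) _
        rw [lintegral_const_mul _ (by exact hm.add hm'), lintegral_add_left hm]
    _ ≤ _ := by gcongr

theorem exists_pos_mul_rpow_le (A : ℝ) {p δ : ℝ} (hp : 0 < p) (hδ : 0 < δ) {b : ℝ} (hb : 0 < b) :
    ∃ h, 0 < h ∧ h ≤ b ∧ A * h ^ p ≤ δ := by
  have h1 : Filter.Tendsto (fun h : ℝ => A * h ^ p) (nhdsWithin 0 (Set.Ioi 0)) (nhds 0) := by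
    have : Continuous fun h : ℝ => A * h ^ p :=
      continuous_const.mul (continuous_rpow_const hp.le)
    simpa [zero_rpow hp.ne'] using (this.tendsto 0).mono_left nhdsWithin_le_nhds
  obtain ⟨h, h2, h3⟩ := ((h1.eventually_lt_const hδ).and (Ioc_mem_nhdsGT hb)).exists
  exact ⟨h, h3.1, h3.2, h2.le⟩

theorem exists_radius_setLIntegral_gaussE_le (d : ℕ) {p : ℝ} (hp : 1 ≤ p) {δ : ℝ} (hδ : 0 < δ) :
    ∃ M : ℝ, 0 ≤ M ∧ ∀ f : EuclideanSpace ℝ (Fin d) → ℝ, ContDiff ℝ 1 f →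
      ∫⁻ x in {x | M < ‖x‖}, ‖f x‖ₑ ^ p ∂(gaussE d) ≤
        ENNReal.ofReal δ * ∫⁻ x, ‖fderiv ℝ f x‖ₑ ^ p ∂(gaussE d) +
          ENNReal.ofReal δ * ∫⁻ x, ‖f x‖ₑ ^ p ∂(gaussE d) := by
  set A : ℝ := 2 * d * 2 ^ (p - 1) with hA
  obtain ⟨h, hh, -, hAh⟩ := exists_pos_mul_rpow_le A (p := p) (by positivity) hδ one_pos
  obtain ⟨R, hAR, hR⟩ : ∃ R, A * exp (h ^ 2 / 2 - h * R) ≤ δ ∧ h ≤ R := by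
    have h1 : Filter.Tendsto (fun R => A * exp (h ^ 2 / 2 - h * R)) Filter.atTop (nhds 0) := by
      rw [← mul_zero A]
      refine (tendsto_exp_atBot.comp ?_).const_mul A
      simp_rw [sub_eq_add_neg]
      exact Filter.tendsto_atBot_add_const_left _ _
        (Filter.tendsto_neg_atTop_atBot.comp (Filter.tendsto_id.const_mul_atTop hh))
    obtain ⟨R, h2, h3⟩ :=
      ((h1.eventually_lt_const hδ).and (Filter.eventually_ge_atTop h)).exists
    exact ⟨R, h2.le, h3⟩
  have hR0 : 0 ≤ R := hh.le.trans hR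
  refine ⟨√d * R, by positivity, fun f hf => ?_⟩
  let e : Fin d × Bool → EuclideanSpace ℝ (Fin d) := fun i =>
    EuclideanSpace.single i.1 (if i.2 then 1 else -1)
  have he : ∀ i, ‖e i‖ = 1 := by
    rintro ⟨i, b⟩
    cases b <;> simp [e]
  have hcover : {x : EuclideanSpace ℝ (Fin d) | √d * R < ‖x‖} ⊆
      ⋃ i, {x | R ≤ inner ℝ x (e i)} := by
    intro x hx
    by_contra hcon
    simp only [Set.mem_iUnion, Set.mem_ofPred_eq, not_exists, not_le] at hcon hx
    refine hx.not_ge (abs_le_of_sq_le_sq' ?_ (by positivity)).2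
    rw [EuclideanSpace.norm_sq_eq, mul_pow, sq_sqrt (by positivity)]
    calc ∑ i, ‖x i‖ ^ 2 ≤ ∑ _i : Fin d, R ^ 2 := by
          refine Finset.sum_le_sum fun i _ => ?_
          have h1 := hcon (i, true)
          have h2 := hcon (i, false)
          simp [e, EuclideanSpace.inner_single_right] at h1 h2
          rw [Real.norm_eq_abs]
          gcongr
          exact abs_le.2 ⟨by linarith, h1.le⟩
      _ = d * R ^ 2 := by simp
  have hcast : ∀ t : ℝ, A * t ≤ δ → (2 * d : ℝ≥0∞) * (2 ^ (p - 1) * ENNReal.ofReal t) ≤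
      ENNReal.ofReal δ := by
    intro t ht
    refine le_trans (le_of_eq ?_) (ENNReal.ofReal_le_ofReal ht)
    rw [hA, ENNReal.ofReal_mul (by positivity), ENNReal.ofReal_mul (by positivity),
      ENNReal.ofReal_mul (by positivity), ← ENNReal.ofReal_rpow_of_pos (by positivity)]
    simp [mul_assoc]
  set G := ∫⁻ x, ‖fderiv ℝ f x‖ₑ ^ p ∂(gaussE d)
  set I := ∫⁻ x, ‖f x‖ₑ ^ p ∂(gaussE d)
  calc ∫⁻ x in {x | √d * R < ‖x‖}, ‖f x‖ₑ ^ p ∂(gaussE d)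
      ≤ ∫⁻ x in ⋃ i, {x | R ≤ inner ℝ x (e i)}, ‖f x‖ₑ ^ p ∂(gaussE d) :=
        lintegral_mono_set hcover
    _ ≤ ∑' i, ∫⁻ x in {x | R ≤ inner ℝ x (e i)}, ‖f x‖ₑ ^ p ∂(gaussE d) :=
        lintegral_iUnion_le _ _
    _ ≤ ∑' _i : Fin d × Bool, 2 ^ (p - 1) * (ENNReal.ofReal h ^ p * G +
          ENNReal.ofReal (exp (h ^ 2 / 2 - h * R)) * I) :=
        ENNReal.tsum_le_tsum fun i => setLIntegral_halfSpace_gaussE_le hf hp (he i) hh hR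
    _ = (2 * d : ℝ≥0∞) * (2 ^ (p - 1) * ENNReal.ofReal (h ^ p)) * G +
          (2 * d : ℝ≥0∞) * (2 ^ (p - 1) * ENNReal.ofReal (exp (h ^ 2 / 2 - h * R))) * I := by
        rw [← ENNReal.ofReal_rpow_of_pos hh, tsum_fintype]
        simp
        ring
    _ ≤ _ := by
        gcongr
        · exact hcast _ hAh
        · exact hcast _ hAR

theorem exists_setLIntegral_closedBall_gaussE_le (d : ℕ) {p : ℝ} (hp : 1 ≤ p) {δ : ℝ}
    (hδ : 0 < δ) {M : ℝ} (hM : 0 ≤ M) :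
    ∃ C : ℝ≥0∞, C ≠ ∞ ∧ ∀ f : EuclideanSpace ℝ (Fin d) → ℝ, ContDiff ℝ 1 f →
      ∫⁻ x in {x | ‖x‖ ≤ M}, ‖f x‖ₑ ^ p ∂(gaussE d) ≤
        ENNReal.ofReal δ * ∫⁻ x, ‖fderiv ℝ f x‖ₑ ^ p ∂(gaussE d) +
          C * (∫⁻ x, ‖f x‖ₑ ∂(gaussE d)) ^ p := by
  have hp0 : 0 < p := one_pos.trans_le hp
  obtain ⟨h, hh, hhb, hle⟩ := exists_pos_mul_rpow_le (2 ^ (p - 1) * exp 2) (p := p) hp0 hδ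
    (b := 1 / (M + 1)) (by positivity)
  have hhM : h * (M + 1) ≤ 1 := by rwa [le_div_iff₀ (by positivity)] at hhb
  set C₁ : ℝ≥0∞ := ENNReal.ofReal ((2 * π) ^ ((d : ℝ) / 2) * exp ((M + h) ^ 2 / 2))
  set V : ℝ≥0∞ := volume (Metric.closedBall (0 : EuclideanSpace ℝ (Fin d)) h) with hV
  have hV0 : V ≠ 0 := (Metric.measure_closedBall_pos volume _ hh).ne'
  refine ⟨2 ^ (p - 1) * ((V⁻¹ * C₁) ^ p * gaussE d {x | ‖x‖ ≤ M}), ?_, fun f hf => ?_⟩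
  · have := measure_ne_top (gaussE d) {x | ‖x‖ ≤ M}
    have h1 : (2 : ℝ≥0∞) ^ (p - 1) ≠ ∞ := ENNReal.rpow_ne_top_of_nonneg (by linarith) (by simp)
    have h2 : (V⁻¹ * C₁) ^ p ≠ ∞ := ENNReal.rpow_ne_top_of_nonneg hp0.le
      (ENNReal.mul_ne_top (ENNReal.inv_ne_top.2 hV0) ENNReal.ofReal_ne_top)
    exact ENNReal.mul_ne_top h1 (ENNReal.mul_ne_top h2 this)
  · have hfin : IsFiniteMeasure (volume.withDensity (gaussDensity d)) := by
      rw [← gaussE_eq_withDensity]; infer_instance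
    have key := setLIntegral_enorm_rpow_withDensity_le_of_comparable (μ := volume)
      (S := {x | ‖x‖ ≤ M}) (K := ENNReal.ofReal (exp 2)) (C := C₁) measurable_gaussDensity hf hp
      (measurableSet_le (by fun_prop) measurable_const) hh
      (by
        intro x hx z hz
        have hx : ‖x‖ ≤ M := hx
        apply gaussDensity_le_mul
        have h1 : ‖x - z‖ ≤ ‖x‖ + h := (norm_sub_le _ _).trans (by gcongr)
        have h2 := pow_le_pow_left₀ (norm_nonneg _) h1 2
        have h3 : ‖x‖ * h ≤ M * h := by gcongr
        have h4 : 0 ≤ h * M := by positivity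
        nlinarith)
      (by
        intro x hx z hz
        have hx : ‖x‖ ≤ M := hx
        exact one_le_mul_gaussDensity ((norm_sub_le _ _).trans (by gcongr)))
    rw [← gaussE_eq_withDensity, ← hV] at key
    refine key.trans ?_
    rw [mul_add]
    gcongr ?_ + ?_
    · rw [← mul_assoc]
      gcongr
      refine le_trans (le_of_eq ?_) (ENNReal.ofReal_le_ofReal hle)
      rw [ENNReal.ofReal_mul (by positivity), ENNReal.ofReal_mul (by positivity),
        ← ENNReal.ofReal_rpow_of_pos hh, ← ENNReal.ofReal_rpow_of_pos (by positivity)]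
      simp [mul_assoc]
    · rw [← mul_assoc V⁻¹, ENNReal.mul_rpow_of_nonneg _ _ hp0.le]
      refine le_of_eq ?_
      ring

theorem exists_lintegral_gaussE_le (d : ℕ) {p : ℝ} (hp : 1 ≤ p) {δ : ℝ} (hδ : 0 < δ) :
    ∃ C : ℝ≥0∞, C ≠ ∞ ∧ ∀ f : EuclideanSpace ℝ (Fin d) → ℝ, ContDiff ℝ 1 f →
      ∫⁻ x, ‖f x‖ₑ ^ p ∂(gaussE d) ≤
        ENNReal.ofReal δ * ∫⁻ x, ‖fderiv ℝ f x‖ₑ ^ p ∂(gaussE d) +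
          ENNReal.ofReal δ * ∫⁻ x, ‖f x‖ₑ ^ p ∂(gaussE d) +
          C * (∫⁻ x, ‖f x‖ₑ ∂(gaussE d)) ^ p := by
  obtain ⟨M, hM, htail⟩ := exists_radius_setLIntegral_gaussE_le d hp (half_pos hδ)
  obtain ⟨C, hC, hball⟩ := exists_setLIntegral_closedBall_gaussE_le d hp (half_pos hδ) hM
  refine ⟨C, hC, fun f hf => ?_⟩
  have hS : MeasurableSet {x : EuclideanSpace ℝ (Fin d) | ‖x‖ ≤ M} :=
    measurableSet_le (by fun_prop) measurable_const
  have hcompl : {x : EuclideanSpace ℝ (Fin d) | ‖x‖ ≤ M}ᶜ = {x | M < ‖x‖} := by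
    ext x; simp
  have hsplit : ENNReal.ofReal δ = ENNReal.ofReal (δ / 2) + ENNReal.ofReal (δ / 2) := by
    rw [← ENNReal.ofReal_add (by positivity) (by positivity), add_halves]
  calc ∫⁻ x, ‖f x‖ₑ ^ p ∂(gaussE d)
      = ∫⁻ x in {x | ‖x‖ ≤ M}, ‖f x‖ₑ ^ p ∂(gaussE d) +
          ∫⁻ x in {x | M < ‖x‖}, ‖f x‖ₑ ^ p ∂(gaussE d) := by
        rw [← hcompl, lintegral_add_compl _ hS]
    _ ≤ _ := add_le_add (hball f hf) (htail f hf)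
    _ = (ENNReal.ofReal (δ / 2) + ENNReal.ofReal (δ / 2)) *
            ∫⁻ x, ‖fderiv ℝ f x‖ₑ ^ p ∂(gaussE d) +
          ENNReal.ofReal (δ / 2) * ∫⁻ x, ‖f x‖ₑ ^ p ∂(gaussE d) +
          C * (∫⁻ x, ‖f x‖ₑ ∂(gaussE d)) ^ p := by ring
    _ ≤ _ := by
        rw [← hsplit]
        gcongr
        linarith

end Gaussian

theorem ofReal_integral_norm_rpow {α F : Type*} [MeasurableSpace α] [NormedAddCommGroup F]
    {μ : Measure α} {g : α → F} {p : ℝ} (hp : 0 ≤ p) (hg : Integrable (fun x => ‖g x‖ ^ p) μ) :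
    ENNReal.ofReal (∫ x, ‖g x‖ ^ p ∂μ) = ∫⁻ x, ‖g x‖ₑ ^ p ∂μ := by
  rw [ofReal_integral_eq_lintegral_ofReal hg (.of_forall fun x => by positivity)]
  refine lintegral_congr fun x => ?_
  rw [← ENNReal.ofReal_rpow_of_nonneg (norm_nonneg _) hp, ofReal_norm]

theorem stmt12 (d : ℕ) (p : ℝ) (hp : 1 < p) (ε : ℝ) (hε : 0 < ε) :
    ∃ C : ℝ, 0 < C ∧
      ∀ f : EuclideanSpace ℝ (Fin d) → ℝ, ContDiff ℝ 1 f →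
        Integrable (fun x => |f x| ^ p) (gaussE d) →
        Integrable (fun x => ‖gradient f x‖ ^ p) (gaussE d) →
        (∫ x, |f x| ^ p ∂(gaussE d)) ^ (1 / p) ≤
          ε * (∫ x, ‖gradient f x‖ ^ p ∂(gaussE d)) ^ (1 / p) +
            C * ∫ x, |f x| ∂(gaussE d) := by
  have hp0 : 0 < p := one_pos.trans hp
  set δ : ℝ := min (1 / 2) (ε ^ p / 2)
  have hδ : 0 < δ := by positivity
  have hδ₁ : δ ≤ 1 / 2 := min_le_left _ _
  have hδ₂ : δ ≤ ε ^ p / 2 := min_le_right _ _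
  obtain ⟨C, hC, hmain⟩ := exists_lintegral_gaussE_le d hp.le hδ
  refine ⟨(2 * C.toReal + 1) ^ (1 / p), by positivity, fun f hf hI hG => ?_⟩
  have hgrad : ∀ x, ‖gradient f x‖ = ‖fderiv ℝ f x‖ := fun x => by simp [gradient]
  simp_rw [hgrad] at hG ⊢
  simp_rw [← Real.norm_eq_abs] at hI ⊢
  have hN : Integrable (fun x => ‖f x‖ ^ (1 : ℝ)) (gaussE d) := by
    refine ((integrable_const 1).add hI).mono'
      (Continuous.aestronglyMeasurable (by simpa using hf.continuous.norm))
      (.of_forall fun x => ?_)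
    simp only [rpow_one, norm_norm, Pi.add_apply]
    rcases le_total ‖f x‖ 1 with h | h
    · have : 0 ≤ ‖f x‖ ^ p := by positivity
      linarith
    · have := self_le_rpow_of_one_le h hp.le
      linarith
  have hN' := ofReal_integral_norm_rpow zero_le_one hN
  simp only [rpow_one, ENNReal.rpow_one] at hN'
  have key := hmain f hf
  rw [← ofReal_integral_norm_rpow hp0.le hI, ← ofReal_integral_norm_rpow hp0.le hG, ← hN',
    ← ENNReal.ofReal_toReal hC] at key
  set I := ∫ x, ‖f x‖ ^ p ∂(gaussE d)
  set G := ∫ x, ‖fderiv ℝ f x‖ ^ p ∂(gaussE d)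
  set N := ∫ x, ‖f x‖ ∂(gaussE d)
  have hI0 : 0 ≤ I := integral_nonneg fun x => by positivity
  have hG0 : 0 ≤ G := integral_nonneg fun x => by positivity
  have hN0 : 0 ≤ N := integral_nonneg fun x => by positivity
  have hC0 : 0 ≤ C.toReal := ENNReal.toReal_nonneg
  rw [ENNReal.ofReal_rpow_of_nonneg hN0 hp0.le, ← ENNReal.ofReal_mul hδ.le,
    ← ENNReal.ofReal_mul hδ.le, ← ENNReal.ofReal_mul hC0,
    ← ENNReal.ofReal_add (by positivity) (by positivity),
    ← ENNReal.ofReal_add (by positivity) (by positivity),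
    ENNReal.ofReal_le_ofReal_iff (by positivity)] at key
  have hNp : 0 ≤ N ^ p := by positivity
  have hbound : I ≤ ε ^ p * G + (2 * C.toReal + 1) * N ^ p := by nlinarith
  calc I ^ (1 / p) ≤ (ε ^ p * G + (2 * C.toReal + 1) * N ^ p) ^ (1 / p) := by gcongr
    _ ≤ (ε ^ p * G) ^ (1 / p) + ((2 * C.toReal + 1) * N ^ p) ^ (1 / p) :=
        rpow_add_le_add_rpow (by positivity) (by positivity) (by positivity)
          ((div_le_one hp0).2 hp.le)
    _ = _ := by
        rw [mul_rpow (by positivity) hG0, mul_rpow (by positivity) hNp, ← rpow_mul hε.le,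
          ← rpow_mul hN0, mul_one_div_cancel hp0.ne', rpow_one, rpow_one]
end
end

section
/- Let ν be a probability measure on a measurable space, let w be a measurable function with values in [0, ∞), let m ≥ 1 and λ > 0 be such that ∫ exp((w/λ)^m) dν ≤ 2. Then for every r ≥ 1 one has (∫ w^r dν)^{1/r} ≤ 2^{1/r} · λ · r^{1/m}. -/
open MeasureTheory Real

theorem rpow_le_rpow_mul_exp_rpow {u m r : ℝ} (hu : 0 ≤ u) (hm : 1 ≤ m) (hr : 0 < r) :
    u ^ r ≤ r ^ (r / m) * Real.exp (u ^ m) := by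
  have hm0 : 0 < m := by linarith
  have hs : 0 < r / m := by positivity
  have ht : u ^ m ≤ r * Real.exp (u ^ m / (r / m)) := by
    have h1 : u ^ m / (r / m) ≤ Real.exp (u ^ m / (r / m)) := by
      linarith [Real.add_one_le_exp (u ^ m / (r / m))]
    calc u ^ m = r / m * (u ^ m / (r / m)) := by field_simp
      _ ≤ r * Real.exp (u ^ m / (r / m)) := by
        gcongr
        exact div_le_self hr.le hm
  calc u ^ r = (u ^ m) ^ (r / m) := by
        rw [← Real.rpow_mul hu, mul_div_cancel₀ _ hm0.ne']
    _ ≤ (r * Real.exp (u ^ m / (r / m))) ^ (r / m) := by gcongr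
    _ = r ^ (r / m) * Real.exp (u ^ m) := by
        rw [Real.mul_rpow hr.le (Real.exp_pos _).le, ← Real.exp_mul, div_mul_cancel₀ _ hs.ne']

theorem stmt16 {Ω : Type*} [MeasurableSpace Ω] (ν : Measure Ω) [IsProbabilityMeasure ν]
    (w : Ω → ℝ) (hwmeas : Measurable w) (hw0 : ∀ x, 0 ≤ w x)
    (m lam : ℝ) (hm : 1 ≤ m) (hlam : 0 < lam)
    (horlicz : ∫⁻ x, ENNReal.ofReal (Real.exp ((w x / lam) ^ m)) ∂ν ≤ 2) :
    ∀ r : ℝ, 1 ≤ r →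
      (∫⁻ x, ENNReal.ofReal (w x ^ r) ∂ν) ^ (1 / r) ≤
        ENNReal.ofReal (2 ^ (1 / r) * lam * r ^ (1 / m)) := by
  intro r hr
  have hr0 : 0 < r := by linarith
  have hpt (x : Ω) : ENNReal.ofReal (w x ^ r) ≤
      ENNReal.ofReal (lam ^ r * r ^ (r / m)) *
        ENNReal.ofReal (Real.exp ((w x / lam) ^ m)) := by
    rw [← ENNReal.ofReal_mul (by positivity)]
    apply ENNReal.ofReal_le_ofReal
    calc w x ^ r = lam ^ r * (w x / lam) ^ r := by
          rw [← Real.mul_rpow hlam.le (div_nonneg (hw0 x) hlam.le), mul_div_cancel₀ _ hlam.ne']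
      _ ≤ lam ^ r * (r ^ (r / m) * Real.exp ((w x / lam) ^ m)) := by
          gcongr
          exact rpow_le_rpow_mul_exp_rpow (div_nonneg (hw0 x) hlam.le) hm hr0
      _ = _ := by ring
  have hint : ∫⁻ x, ENNReal.ofReal (w x ^ r) ∂ν ≤
      ENNReal.ofReal (lam ^ r * r ^ (r / m) * 2) :=
    calc ∫⁻ x, ENNReal.ofReal (w x ^ r) ∂ν
        ≤ ∫⁻ x, ENNReal.ofReal (lam ^ r * r ^ (r / m)) *
            ENNReal.ofReal (Real.exp ((w x / lam) ^ m)) ∂ν := lintegral_mono hpt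
      _ = ENNReal.ofReal (lam ^ r * r ^ (r / m)) *
            ∫⁻ x, ENNReal.ofReal (Real.exp ((w x / lam) ^ m)) ∂ν :=
          lintegral_const_mul' _ _ ENNReal.ofReal_ne_top
      _ ≤ ENNReal.ofReal (lam ^ r * r ^ (r / m)) * 2 := by gcongr
      _ = ENNReal.ofReal (lam ^ r * r ^ (r / m) * 2) := by
          rw [ENNReal.ofReal_mul (q := 2) (by positivity), ENNReal.ofReal_ofNat]
  calc (∫⁻ x, ENNReal.ofReal (w x ^ r) ∂ν) ^ (1 / r)
      ≤ ENNReal.ofReal (lam ^ r * r ^ (r / m) * 2) ^ (1 / r) := by gcongr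
    _ = ENNReal.ofReal ((lam ^ r * r ^ (r / m) * 2) ^ (1 / r)) :=
        ENNReal.ofReal_rpow_of_nonneg (by positivity) (by positivity)
    _ = ENNReal.ofReal (2 ^ (1 / r) * lam * r ^ (1 / m)) := by
        rw [Real.mul_rpow (by positivity) (by positivity),
          Real.mul_rpow (by positivity) (by positivity), ← Real.rpow_mul hlam.le,
          ← Real.rpow_mul hr0.le, mul_one_div_cancel hr0.ne', Real.rpow_one,
          show r / m * (1 / r) = 1 / m by field_simp]
        congr 1
        ring
end
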